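/- If G is a smallest counterexample and p(G) = 2, then G has at least 22 vertices. -/

import Mathlib

open SimpleGraph

/-- The degree of a vertex, as the cardinality of its neighbor set. -/
noncomputable def deg {V : Type} (G : SimpleGraph V) (v : V) : ℕ :=
  (G.neighborSet v).ncard

/-- The potential of a finite graph: `5 n(G) - 4 e(G)`. -/
noncomputable def pot {V : Type} [Fintype V] (G : SimpleGraph V) : ℤ :=
  5 * (Fintype.card V : ℤ) - 4 * (G.edgeSet.ncard : ℤ)

/-- A graph is 5/2-critical if it has no homomorphism to the 5-cycle
but every proper subgraph has one. -/
def Critical52 {V : Type} (G : SimpleGraph V) : Prop :=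
  IsEmpty (G →g cycleGraph 5) ∧
  ∀ H : G.Subgraph, H ≠ ⊤ → Nonempty (H.coe →g cycleGraph 5)

/-- The exceptional graph `E₁`: a 9-cycle `0 1 2 3 4 5 6 7 8` together
with a vertex `9` adjacent to `0`, `3` and `6`. -/
def E1 : SimpleGraph (Fin 10) := SimpleGraph.fromEdgeSet
  {s(0,1), s(1,2), s(2,3), s(3,4), s(4,5), s(5,6), s(6,7), s(7,8), s(8,0),
   s(9,0), s(9,3), s(9,6)}

/-- The exceptional graph `E₂`: two 5-cycles `0 1 2 3 4` and `0 1 5 6 7`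
sharing exactly the edge `01`, together with a path `3 8 9 6`. -/
def E2 : SimpleGraph (Fin 10) := SimpleGraph.fromEdgeSet
  {s(0,1), s(1,2), s(2,3), s(3,4), s(4,0),
   s(1,5), s(5,6), s(6,7), s(7,0),
   s(3,8), s(8,9), s(9,6)}

/-- A smallest counterexample: a 5/2-critical graph, not isomorphic to `C₃`, `E₁`, `E₂`,
with potential at least 2, such that every smaller 5/2-critical graph not isomorphic
to `C₃`, `E₁`, `E₂` has potential at most 1. -/
def SmallestCex {V : Type} [Fintype V] (G : SimpleGraph V) : Prop :=
  Critical52 G ∧ IsEmpty (G ≃g cycleGraph 3) ∧ IsEmpty (G ≃g E1) ∧ IsEmpty (G ≃g E2) ∧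
  2 ≤ pot G ∧
  ∀ (m : ℕ) (H : SimpleGraph (Fin m)), Critical52 H →
    IsEmpty (H ≃g cycleGraph 3) → IsEmpty (H ≃g E1) → IsEmpty (H ≃g E2) →
    m < Fintype.card V → pot H ≤ 1

/-- A string: a path of positive length whose endvertices have degree at least 3
and whose internal vertices have degree 2. A `k`-string is a string of length `k+1`. -/
def IsString {V : Type} (G : SimpleGraph V) {u v : V} (p : G.Walk u v) : Prop :=
  p.IsPath ∧ 0 < p.length ∧ 3 ≤ deg G u ∧ 3 ≤ deg G v ∧
  ∀ w ∈ p.support, w ≠ u → w ≠ v → deg G w = 2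

/-- `v` lies on a 5-cycle of `G`. -/
def InFiveCycle {V : Type} (G : SimpleGraph V) (v : V) : Prop :=
  ∃ (w : V) (c : G.Walk w w), c.IsCycle ∧ c.length = 5 ∧ v ∈ c.support

/-- `v` is a `(k₁,k₂,k₃)`-vertex: it has degree 3 and is the end of a `k₁`-string,
a `k₂`-string and a `k₃`-string leaving `v` through its three distinct edges. -/
def IsVertex3 {V : Type} (G : SimpleGraph V) (v : V) (k1 k2 k3 : ℕ) : Prop :=
  deg G v = 3 ∧ ∃ (u1 u2 u3 : V) (p1 : G.Walk v u1) (p2 : G.Walk v u2) (p3 : G.Walk v u3),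
    IsString G p1 ∧ IsString G p2 ∧ IsString G p3 ∧
    p1.getVert 1 ≠ p2.getVert 1 ∧ p1.getVert 1 ≠ p3.getVert 1 ∧ p2.getVert 1 ≠ p3.getVert 1 ∧
    p1.length = k1 + 1 ∧ p2.length = k2 + 1 ∧ p3.length = k3 + 1

/-- `v` is a `(k₁,k₂,k₃,k₄)`-vertex: it has degree 4 and is the end of strings of the
corresponding lengths leaving `v` through its four distinct edges. -/
def IsVertex4 {V : Type} (G : SimpleGraph V) (v : V) (k1 k2 k3 k4 : ℕ) : Prop :=
  deg G v = 4 ∧ ∃ (u1 u2 u3 u4 : V) (p1 : G.Walk v u1) (p2 : G.Walk v u2)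
    (p3 : G.Walk v u3) (p4 : G.Walk v u4),
    IsString G p1 ∧ IsString G p2 ∧ IsString G p3 ∧ IsString G p4 ∧
    p1.getVert 1 ≠ p2.getVert 1 ∧ p1.getVert 1 ≠ p3.getVert 1 ∧ p1.getVert 1 ≠ p4.getVert 1 ∧
    p2.getVert 1 ≠ p3.getVert 1 ∧ p2.getVert 1 ≠ p4.getVert 1 ∧ p3.getVert 1 ≠ p4.getVert 1 ∧
    p1.length = k1 + 1 ∧ p2.length = k2 + 1 ∧ p3.length = k3 + 1 ∧ p4.length = k4 + 1

/-- `H` contains at least two distinct cycles, where cycles are counted as subgraphs,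
i.e. two cycles are distinct if their edge sets differ. -/
def TwoDistinctCycles {V : Type} (H : SimpleGraph V) : Prop :=
  ∃ (v1 v2 : V) (c1 : H.Walk v1 v1) (c2 : H.Walk v2 v2),
    c1.IsCycle ∧ c2.IsCycle ∧ {e | e ∈ c1.edges} ≠ {e | e ∈ c2.edges}

/-- The degree of a 5-cycle (cell) `c` in `G`: the number of strings not contained in `c`
that intersect `c`, strings being counted by their edge sets. -/
noncomputable def cellDegree {V : Type} (G : SimpleGraph V) {w : V} (c : G.Walk w w) : ℕ :=
  {S : Set (Sym2 V) | ∃ (u v : V) (p : G.Walk u v), IsString G p ∧ S = {e | e ∈ p.edges} ∧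
    ¬ S ⊆ {e | e ∈ c.edges} ∧ ∃ x ∈ p.support, x ∈ c.support}.ncard


/-! ## Part 1: the finite search, in a form the kernel can evaluate -/

-- ranks of pairs: 0 none, 1 = path of length 2, 2 = edge, 3 = path of length 3, 4 = lengths 2 and 3
def rNS (r : Nat) : Nat := [0,1,1,1,2].getD r 0
def rK (r : Nat) : Nat := [0,1,0,2,3].getD r 0
def rZ (r : Nat) : Nat := [0,2,3,1,3].getD r 0
def rCode (r : Nat) : Nat := [0, 65537, 65552, 65792, 135168].getD r 0

/-- differences allowed for a pair of a given rank -/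
def okd (r d : Nat) : Bool := match r, d with
  | 0, _ => true
  | 1, 0 => true | 1, 2 => true | 1, 3 => true
  | 2, 1 => true | 2, 4 => true
  | 3, 1 => true | 3, 2 => true | 3, 3 => true | 3, 4 => true
  | 4, 2 => true | 4, 3 => true
  | _, _ => false

/-- rank triples that cannot occur on three branch vertices -/
def badT (a b c : Nat) : Bool :=
  let srt := fun (x y z : Nat) =>
    ([[2,2,2],[1,2,2],[3,1,2],[4,2,2],[4,1,2],[4,3,2],[4,4,2],[4,4,4]].contains [x,y,z])
  srt a b c || srt a c b || srt b a c || srt b c a || srt c a b || srt c b a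

def B24 : Nat := 16777216
def G23 : Nat := 8388608

/-- weight of a cell `(i, j)` of rank `r` in field `f` -/
def wt (N f i j r : Nat) : Nat :=
  if f < 5 then (match f with
    | 0 => rNS r | 1 => rK r | 2 => 2 * rNS r - rK r | 3 => rNS r | _ => rK r)
  else
    let k := (f - 5) / N
    let v := (f - 5) % N
    match k with
    | 0 => if v = i ∨ v = j then rNS r else 0
    | 1 => if v = i ∨ v = j then rZ r else 0
    | 2 => (if i ≤ v then rNS r else 0) + (if j ≤ v then rNS r else 0)
    | 3 => if v = i ∨ v = j then rCode r else 0
    | _ => if i ≤ v ∧ v < j then rNS r else 0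

def initF (n N f : Nat) : Nat :=
  let E := N + (n-2)/4
  let K := n - N
  let ex := 2*E - 3*N
  if f < 5 then (match f with
    | 0 => G23 - 1 - E | 1 => G23 - 1 - K | 2 => G23 - 1 + K - 2*E | 3 => G23 - E | _ => G23 - K)
  else
    let k := (f - 5) / N
    let v := (f - 5) % N
    match k with
    | 0 => G23 - (if v = 0 then (2*E + N - 1)/N else 3)
    | 1 => G23 - 5
    | 2 => G23 - 1 - (3*(v+1)+ex)
    | 3 => 0
    | _ => G23 - 1

/-- fields tested to be small at a cell in row `i` -/
def tLe (N f i : Nat) : Bool :=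
  if f < 5 then f < 3 else
    match (f - 5) / N with
    | 2 => true
    | 3 => decide (0 < i)
    | _ => false

/-- fields tested to be large at the cell `(i, j)` -/
def tGe (N f i j : Nat) : Bool :=
  if j + 1 = N then
   if f < 5 then (decide (3 ≤ f)) && decide (i + 2 = N) else
    let v := (f - 5) % N
    match (f - 5) / N with
    | 0 => decide (v = i) || (decide (i + 2 = N) && decide (v = j))
    | 1 => decide (v = i) || (decide (i + 2 = N) && decide (v = j))
    | 4 => decide (v = i)
    | _ => false
  else false

def pack (F : Nat) (x : Nat → Nat) : Nat := F.rec 0 (fun f ih => ih + x f * B24 ^ f)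

structure Cell where
  (tb ntb M Ex top shp a1 a2 a3 a4 p1 p2 p3 p4 q1 q2 q3 q4 s1 s2 s3 s4 x1 x2 x3 x4 : Nat)

def qbits (N i k a : Nat) : Nat :=
  if N < 4 then 0 else
  (List.range 16).foldl (fun acc t =>
     if badT a (t%4+1) (t/4+1) then acc ||| 2^(128*i + 32*(t/4) + 8*(t%4) + k) else acc) 0

def cls (L : Nat) (pl : List Nat) (v c : Nat) : Nat :=
  let ones := 2^L - 1
  let s := fun b => if c.testBit b then pl.getD (3*v+b) 0 else (pl.getD (3*v+b) 0) ^^^ ones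
  s 0 &&& s 1 &&& s 2

def xm (L : Nat) (pl : List Nat) (i j r : Nat) : Nat :=
  (List.range 25).foldl (fun acc t =>
    if okd r (t%5) then acc ||| (cls L pl i (t/5) &&& cls L pl j ((t/5+t%5)%5)) else acc) 0

def topR (n N i : Nat) : Nat :=
  if 2 ≤ 2*(N + (n-2)/4) - 3*N ∨ (2*(N + (n-2)/4) - 3*N = 1 ∧ i = 0) then 4 else 3

def mkC (n N L : Nat) (pl : List Nat) (c : Nat × Nat) : Cell :=
  let i := c.1
  let j := c.2
  let F := 5 + 5*N
  { tb := if j = i+1 then 0 else 2^j, ntb := 2^N - 1 - 2^j,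
    M := pack F (fun f => if tLe N f i || tGe N f i j then G23 else 0)
    Ex := pack F (fun f => if tGe N f i j then G23 else 0)
    top := topR n N i
    shp := 32*j
    a1 := pack F (fun f => wt N f i j 1), a2 := pack F (fun f => wt N f i j 2)
    a3 := pack F (fun f => wt N f i j 3), a4 := pack F (fun f => wt N f i j 4)
    p1 := 2^(32*j + i), p2 := 2^(32*j+8+i), p3 := 2^(32*j+16+i), p4 := 2^(32*j+24+i)
    q1 := qbits N j i 1, q2 := qbits N j i 2, q3 := qbits N j i 3, q4 := qbits N j i 4
    s1 := 128*i, s2 := 128*i+32, s3 := 128*i+64, s4 := 128*i+96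
    x1 := xm L pl i j 1, x2 := xm L pl i j 2, x3 := xm L pl i j 3, x4 := xm L pl i j 4 }

/-- continuations of the search; the arguments are `A P Q T pr X` -/
abbrev KT := Nat → Nat → Nat → Nat → Nat → Nat → Bool

noncomputable def newT (T ntb pr r : Nat) : Nat := Bool.rec (Nat.land T ntb) T (Nat.beq pr r)

noncomputable def stepC (c : Cell) (next : KT) : KT := fun A P Q T pr X =>
  Cell.rec (fun tb ntb M Ex top shp a1 a2 a3 a4 p1 p2 p3 p4 q1 q2 q3 q4 s1 s2 s3 s4 x1 x2 x3 x4 =>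
   (fun (o0 : Bool) => (fun (o1 : Bool) => (fun (o2 : Bool) => (fun (o3 : Bool) =>
     Nat.rec o0 (fun l _ => Nat.rec o1 (fun l _ => Nat.rec o2 (fun l _ => Nat.rec o3 (fun _ _ =>
      (Bool.rec o3 (Bool.rec o3 (Bool.rec false o3
        (next (Nat.add A a4) (Nat.lor P p4) (Nat.lor Q q4) (newT T ntb pr 4) 4 (Nat.land X x4)))
       (Nat.beq (Nat.land (Nat.shiftRight Q s4) (Nat.land (Nat.shiftRight P shp) 4294967295)) 0))
       (Nat.beq (Nat.land (Nat.add A a4) M) Ex))) l) l) l)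
       (Nat.rec top (fun _ _ => pr) (Nat.land T tb)))
      (Bool.rec o2 (Bool.rec o2 (Bool.rec false o2
        (next (Nat.add A a3) (Nat.lor P p3) (Nat.lor Q q3) (newT T ntb pr 3) 3 (Nat.land X x3)))
       (Nat.beq (Nat.land (Nat.shiftRight Q s3) (Nat.land (Nat.shiftRight P shp) 4294967295)) 0))
       (Nat.beq (Nat.land (Nat.add A a3) M) Ex)))
      (Bool.rec o1 (Bool.rec o1 (Bool.rec false o1
        (next (Nat.add A a2) (Nat.lor P p2) (Nat.lor Q q2) (newT T ntb pr 2) 2 (Nat.land X x2)))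
       (Nat.beq (Nat.land (Nat.shiftRight Q s2) (Nat.land (Nat.shiftRight P shp) 4294967295)) 0))
       (Nat.beq (Nat.land (Nat.add A a2) M) Ex)))
      (Bool.rec o0 (Bool.rec o0 (Bool.rec false o0
        (next (Nat.add A a1) (Nat.lor P p1) (Nat.lor Q q1) (newT T ntb pr 1) 1 (Nat.land X x1)))
       (Nat.beq (Nat.land (Nat.shiftRight Q s1) (Nat.land (Nat.shiftRight P shp) 4294967295)) 0))
       (Nat.beq (Nat.land (Nat.add A a1) M) Ex)))
     (Bool.rec true (next A P Q (newT T ntb pr 0) 0 X) (Nat.beq (Nat.land A M) Ex))) c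

noncomputable def srch (cs : List Cell) (k : KT) : KT := List.rec k (fun c _ ih => stepC c ih) cs

noncomputable def leaf (exc : List Nat) : KT := fun _ P _ _ _ X =>
  Bool.rec true (List.rec false (fun e _ ih => Bool.rec ih true (Nat.beq P e)) exc) (Nat.beq X 0)

def cellsA (N : Nat) : List (Nat × Nat) := (List.range (N-1)).map (fun j => (0, j+1))
def cellsB (N : Nat) : List (Nat × Nat) :=
  (List.range (N-2)).flatMap (fun i => (List.range (N-2-i)).map (fun j => (i+1, i+j+2)))

noncomputable def phaseB (n N L : Nat) (pl exc : List Nat) (m k : Nat) : KT :=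
  fun A P Q T pr X => Bool.rec true
      (srch ((cellsB N).map (mkC n N L pl)) (leaf exc)
       (Nat.add A (Nat.mul (pack (5+5*N) (fun f => if 5 ≤ f ∧ (f - 5)/N = 3 then 1 else 0))
         (Nat.sub (G23 - 1) (Nat.land (Nat.shiftRight A (24*(5+3*N))) 16777215)))) P Q T pr X)
      (Nat.beq (Nat.mod P m) k)

noncomputable def runS (n N L : Nat) (pl exc : List Nat) (m k : Nat) : Bool :=
  srch ((cellsA N).map (mkC n N L pl)) (phaseB n N L pl exc m k)
    (pack (5+5*N) (initF n N)) 0 0 (2^N-1) 0 (2^L-1)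

/-! ## Soundness of the search -/

section Packing

theorem pack_zero (x : ℕ → ℕ) : pack 0 x = 0 := rfl
theorem pack_succ (F : ℕ) (x : ℕ → ℕ) : pack (F+1) x = pack F x + x F * B24 ^ F := rfl

theorem pack_add (F : ℕ) (x y : ℕ → ℕ) : pack F x + pack F y = pack F (fun f => x f + y f) := by
  induction F with
  | zero => rfl
  | succ F ih => simp only [pack_succ, ← ih]; ring

theorem pack_mul (F : ℕ) (x : ℕ → ℕ) (a : ℕ) : pack F x * a = pack F (fun f => x f * a) := by
  induction F with
  | zero => simp [pack_zero]
  | succ F ih => simp only [pack_succ, ← ih]; ring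

theorem pack_congr {F : ℕ} {x y : ℕ → ℕ} (h : ∀ f < F, x f = y f) : pack F x = pack F y := by
  induction F with
  | zero => rfl
  | succ F ih =>
    rw [pack_succ, pack_succ, ih (fun f hf => h f (by omega)), h F (by omega)]

theorem pack_lt {F : ℕ} {x : ℕ → ℕ} (h : ∀ f < F, x f < B24) : pack F x < B24 ^ F := by
  induction F with
  | zero => simp [pack_zero]
  | succ F ih =>
    rw [pack_succ, pow_succ]
    have h1 := ih (fun f hf => h f (by omega))
    have h2 : (x F + 1) * B24 ^ F ≤ B24 * B24 ^ F := Nat.mul_le_mul_right _ (h F (by omega))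
    nlinarith

theorem B24_pow (F : ℕ) : B24 ^ F = 2 ^ (24 * F) := by
  rw [pow_mul]; rfl

theorem pack_testBit {F : ℕ} {x : ℕ → ℕ} (h : ∀ f < F, x f < B24) (t : ℕ) :
    (pack F x).testBit t = if t < 24 * F then (x (t / 24)).testBit (t % 24) else false := by
  induction F with
  | zero => simp [pack_zero]
  | succ F ih =>
    have h1 := ih (fun f hf => h f (by omega))
    have h2 := pack_lt (F := F) (x := x) (fun f hf => h f (by omega))
    rw [B24_pow] at h2
    rw [pack_succ, B24_pow, add_comm, mul_comm, Nat.testBit_two_pow_mul_add _ h2, h1]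
    by_cases h3 : t < 24 * F
    · rw [if_pos h3, if_pos h3, if_pos (by omega)]
    · rw [if_neg h3]
      by_cases h4 : t < 24 * (F + 1)
      · rw [if_pos h4]
        have : t / 24 = F := by omega
        rw [this]
        congr 1
        omega
      · rw [if_neg h4]
        apply Nat.testBit_lt_two_pow
        have h5 := h F (by omega)
        calc x F < 2 ^ 24 := h5
          _ ≤ 2 ^ (t - 24 * F) := Nat.pow_le_pow_right (by norm_num) (by omega)

theorem pack_land {F : ℕ} {x m : ℕ → ℕ} (hx : ∀ f < F, x f < B24) (hm : ∀ f < F, m f < B24) :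
    Nat.land (pack F x) (pack F m) = pack F (fun f => Nat.land (x f) (m f)) := by
  have hl : ∀ f < F, Nat.land (x f) (m f) < B24 := fun f hf =>
    lt_of_le_of_lt (Nat.and_le_left (n := x f) (m := m f)) (hx f hf)
  apply Nat.eq_of_testBit_eq
  intro t
  rw [pack_testBit hl]
  change (pack F x &&& pack F m).testBit t = _
  rw [Nat.testBit_and, pack_testBit hx, pack_testBit hm]
  split_ifs
  · change _ = ((x (t/24)) &&& (m (t/24))).testBit _
    rw [Nat.testBit_and]
  · rfl

theorem pack_get {F : ℕ} {x : ℕ → ℕ} (hx : ∀ f < F, x f < B24) {f : ℕ} (hf : f < F) :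
    Nat.land (Nat.shiftRight (pack F x) (24 * f)) 16777215 = x f := by
  apply Nat.eq_of_testBit_eq
  intro t
  change (((pack F x) >>> (24 * f)) &&& (2 ^ 24 - 1)).testBit t = _
  rw [Nat.testBit_and, Nat.testBit_shiftRight, pack_testBit hx, Nat.testBit_two_pow_sub_one]
  by_cases h : t < 24
  · have h1 : 24 * f + t < 24 * F := by omega
    have h2 : (24 * f + t) / 24 = f := by omega
    have h3 : (24 * f + t) % 24 = t := by omega
    simp [h1, h2, h3, h]
  · simp only [h, decide_false, Bool.and_false]
    symm
    apply Nat.testBit_lt_two_pow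
    calc x f < 2 ^ 24 := hx f hf
      _ ≤ 2 ^ t := Nat.pow_le_pow_right (by norm_num) (by omega)

theorem land_G23_lt {x : ℕ} (h : x < G23) : Nat.land x G23 = 0 := by
  change x &&& 2 ^ 23 = 0
  rw [Nat.and_two_pow, Nat.testBit_lt_two_pow (show x < 2 ^ 23 from h)]; rfl

theorem land_G23_ge {x : ℕ} (h : G23 ≤ x) (h2 : x < B24) : Nat.land x G23 = G23 := by
  change x &&& 2 ^ 23 = 2 ^ 23
  have h3 : x.testBit 23 = true := by
    rw [Nat.testBit_eq_decide_div_mod_eq]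
    have : G23 = 8388608 := rfl
    have : B24 = 16777216 := rfl
    simp
    omega
  rw [Nat.and_two_pow, h3]; rfl

end Packing

/-- A state of the search. -/
structure St where
  (A P Q T pr X : ℕ)

def KT.run (k : KT) (s : St) : Bool := k s.A s.P s.Q s.T s.pr s.X

def Cell.a (c : Cell) : ℕ → ℕ
  | 0 => 0 | 1 => c.a1 | 2 => c.a2 | 3 => c.a3 | _ => c.a4
def Cell.p (c : Cell) : ℕ → ℕ
  | 0 => 0 | 1 => c.p1 | 2 => c.p2 | 3 => c.p3 | _ => c.p4
def Cell.q (c : Cell) : ℕ → ℕ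
  | 0 => 0 | 1 => c.q1 | 2 => c.q2 | 3 => c.q3 | _ => c.q4
def Cell.s (c : Cell) : ℕ → ℕ
  | 0 => 0 | 1 => c.s1 | 2 => c.s2 | 3 => c.s3 | _ => c.s4
def Cell.x (c : Cell) (X : ℕ) : ℕ → ℕ
  | 0 => X | 1 => Nat.land X c.x1 | 2 => Nat.land X c.x2 | 3 => Nat.land X c.x3
  | _ => Nat.land X c.x4

noncomputable def stp (c : Cell) (r : ℕ) (s : St) : St :=
  ⟨s.A + c.a r, s.P ||| c.p r, s.Q ||| c.q r, newT s.T c.ntb s.pr r, r, c.x s.X r⟩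

structure OkC (c : Cell) (r : ℕ) (s : St) : Prop where
  r4 : r ≤ 4
  lim : r ≤ if Nat.land s.T c.tb = 0 then c.top else s.pr
  tA : Nat.land (s.A + c.a r) c.M = c.Ex
  tQ : r ≠ 0 → Nat.land (Nat.shiftRight s.Q (c.s r))
    (Nat.land (Nat.shiftRight s.P c.shp) 4294967295) = 0

theorem br_sound {t1 t2 nx rest : Bool}
    (h : (Bool.rec rest (Bool.rec rest (Bool.rec false rest nx : Bool) t2 : Bool) t1 : Bool) = true) :
    rest = true ∧ (t1 = true → t2 = true → nx = true) := by
  cases t1 <;> cases t2 <;> cases nx <;> simp_all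

theorem lim_sound {o0 o1 o2 o3 o4 : Bool} {l : ℕ}
    (h : (Nat.rec o0 (fun l _ => Nat.rec o1 (fun l _ => Nat.rec o2 (fun l _ => Nat.rec o3
      (fun _ _ => o4) l) l) l) l : Bool) = true)
    (e4 : o4 = true → o3 = true) (e3 : o3 = true → o2 = true) (e2 : o2 = true → o1 = true)
    (e1 : o1 = true → o0 = true) :
    o0 = true ∧ (1 ≤ l → o1 = true) ∧ (2 ≤ l → o2 = true) ∧ (3 ≤ l → o3 = true) ∧
      (4 ≤ l → o4 = true) := by
  rcases l with _ | _ | _ | _ | l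
  · exact ⟨h, by omega, by omega, by omega, by omega⟩
  · exact ⟨e1 h, fun _ => h, by omega, by omega, by omega⟩
  · exact ⟨e1 (e2 h), fun _ => e2 h, fun _ => h, by omega, by omega⟩
  · exact ⟨e1 (e2 (e3 h)), fun _ => e2 (e3 h), fun _ => e3 h, fun _ => h, by omega⟩
  · exact ⟨e1 (e2 (e3 (e4 h))), fun _ => e2 (e3 (e4 h)), fun _ => e3 (e4 h), fun _ => e4 h, fun _ => h⟩

theorem stepC_sound {c : Cell} {next : KT} {s : St} {r : ℕ}
    (h : (stepC c next).run s = true) (ok : OkC c r s) : next.run (stp c r s) = true := by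
  obtain ⟨r4, lim, tA, tQ⟩ := ok
  obtain ⟨A, P, Q, T, pr, X⟩ := s
  cases c with
  | mk tb ntb M Ex top shp a1 a2 a3 a4 p1 p2 p3 p4 q1 q2 q3 q4 s1 s2 s3 s4 x1 x2 x3 x4 =>
  simp only [stepC, KT.run] at h
  have hl : (Nat.rec top (fun _ _ => pr) (Nat.land T tb) : ℕ)
      = if Nat.land T tb = 0 then top else pr := by
    cases Nat.land T tb <;> simp
  rw [hl] at h
  simp only at lim tA tQ
  generalize (if Nat.land T tb = 0 then top else pr) = l at h lim
  set o0 : Bool := Bool.rec true (next A P Q (newT T ntb pr 0) 0 X) (Nat.beq (Nat.land A M) Ex) with ho0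
  set o1 : Bool := (Bool.rec o0 (Bool.rec o0 (Bool.rec false o0
        (next (Nat.add A a1) (Nat.lor P p1) (Nat.lor Q q1) (newT T ntb pr 1) 1 (Nat.land X x1)))
       (Nat.beq (Nat.land (Nat.shiftRight Q s1) (Nat.land (Nat.shiftRight P shp) 4294967295)) 0))
       (Nat.beq (Nat.land (Nat.add A a1) M) Ex)) with ho1
  set o2 : Bool := (Bool.rec o1 (Bool.rec o1 (Bool.rec false o1
        (next (Nat.add A a2) (Nat.lor P p2) (Nat.lor Q q2) (newT T ntb pr 2) 2 (Nat.land X x2)))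
       (Nat.beq (Nat.land (Nat.shiftRight Q s2) (Nat.land (Nat.shiftRight P shp) 4294967295)) 0))
       (Nat.beq (Nat.land (Nat.add A a2) M) Ex)) with ho2
  set o3 : Bool := (Bool.rec o2 (Bool.rec o2 (Bool.rec false o2
        (next (Nat.add A a3) (Nat.lor P p3) (Nat.lor Q q3) (newT T ntb pr 3) 3 (Nat.land X x3)))
       (Nat.beq (Nat.land (Nat.shiftRight Q s3) (Nat.land (Nat.shiftRight P shp) 4294967295)) 0))
       (Nat.beq (Nat.land (Nat.add A a3) M) Ex)) with ho3
  set o4 : Bool := (Bool.rec o3 (Bool.rec o3 (Bool.rec false o3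
        (next (Nat.add A a4) (Nat.lor P p4) (Nat.lor Q q4) (newT T ntb pr 4) 4 (Nat.land X x4)))
       (Nat.beq (Nat.land (Nat.shiftRight Q s4) (Nat.land (Nat.shiftRight P shp) 4294967295)) 0))
       (Nat.beq (Nat.land (Nat.add A a4) M) Ex)) with ho4
  have e4 : o4 = true → o3 = true ∧ _ := fun h => br_sound h
  have e3 : o3 = true → o2 = true ∧ _ := fun h => br_sound h
  have e2 : o2 = true → o1 = true ∧ _ := fun h => br_sound h
  have e1 : o1 = true → o0 = true ∧ _ := fun h => br_sound h
  have e0 : o0 = true → (Nat.beq (Nat.land A M) Ex = true → 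
      next A P Q (newT T ntb pr 0) 0 X = true) := by
    rw [ho0]; intro h1 h2; rw [h2] at h1; exact h1
  clear_value o0 o1 o2 o3 o4
  obtain ⟨k0, k1, k2, k3, k4⟩ := lim_sound h (fun h => (e4 h).1) (fun h => (e3 h).1)
    (fun h => (e2 h).1) (fun h => (e1 h).1)
  have hz : ∀ a, Nat.lor a 0 = a := fun a => Nat.or_zero a
  rcases r with _ | _ | _ | _ | _ | r
  · have := e0 k0 (by rw [Nat.beq_eq]; exact tA)
    simpa [KT.run, stp, Cell.a, Cell.p, Cell.q, Cell.x] using this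
  · exact (e1 (k1 lim)).2 (by rw [Nat.beq_eq]; exact tA) (by rw [Nat.beq_eq]; exact tQ (by omega))
  · exact (e2 (k2 lim)).2 (by rw [Nat.beq_eq]; exact tA) (by rw [Nat.beq_eq]; exact tQ (by omega))
  · exact (e3 (k3 lim)).2 (by rw [Nat.beq_eq]; exact tA) (by rw [Nat.beq_eq]; exact tQ (by omega))
  · exact (e4 (k4 lim)).2 (by rw [Nat.beq_eq]; exact tA) (by rw [Nat.beq_eq]; exact tQ (by omega))
  · omega

theorem srch_cons (c : Cell) (cs : List Cell) (k : KT) : srch (c :: cs) k = stepC c (srch cs k) := rfl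

theorem foldl_lor_testBit (p : ℕ → Bool) (g : ℕ → ℕ) (b : ℕ) : ∀ (l : List ℕ) (acc : ℕ),
    (l.foldl (fun acc t => if p t then acc ||| g t else acc) acc).testBit b = true →
    acc.testBit b = true ∨ ∃ t ∈ l, p t = true ∧ (g t).testBit b = true := by
  intro l
  induction l with
  | nil => intro acc h; exact Or.inl h
  | cons t l ih =>
    intro acc h
    rw [List.foldl_cons] at h
    rcases ih _ h with h1 | ⟨t', ht', h1⟩
    · by_cases hp : p t = true
      · rw [if_pos hp, Nat.testBit_or, Bool.or_eq_true] at h1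
        rcases h1 with h1 | h1
        · exact Or.inl h1
        · exact Or.inr ⟨t, by simp, hp, h1⟩
      · rw [if_neg hp] at h1
        exact Or.inl h1
    · exact Or.inr ⟨t', by simp [ht'], h1⟩

theorem qbits_testBit {N i k a b : ℕ} (h : (qbits N i k a).testBit b = true) :
    4 ≤ N ∧ ∃ x y, x < 4 ∧ y < 4 ∧ badT a (x+1) (y+1) = true ∧ b = 128*i + 32*y + 8*x + k := by
  unfold qbits at h
  split_ifs at h with hN
  · simp at h
  · refine ⟨by omega, ?_⟩
    rcases foldl_lor_testBit (fun t => badT a (t%4+1) (t/4+1))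
      (fun t => 2^(128*i + 32*(t/4) + 8*(t%4) + k)) b _ _ h with h | ⟨t, ht, h1, h2⟩
    · simp at h
    · rw [Nat.testBit_two_pow] at h2
      have ht' := List.mem_range.1 ht
      exact ⟨t % 4, t / 4, by omega, by omega, h1, by simp at h2; omega⟩

/-- colour of vertex `v` in the `b`-th test colouring -/
def tcol (pl : List ℕ) (b v : ℕ) : Fin 5 :=
  Fin.ofNat 5 ((pl.getD (3*v) 0).testBit b).toNat + 2 * Fin.ofNat 5 ((pl.getD (3*v+1) 0).testBit b).toNat
    + 4 * Fin.ofNat 5 ((pl.getD (3*v+2) 0).testBit b).toNat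

theorem cls_testBit {L : ℕ} {pl : List ℕ} {v c b : ℕ} (hb : b < L) (hc : c < 5)
    (h : (cls L pl v c).testBit b = true) : tcol pl b v = Fin.ofNat 5 c := by
  unfold cls at h
  simp only [Nat.testBit_and, Bool.and_eq_true, add_zero] at h
  obtain ⟨⟨h0, h1⟩, h2⟩ := h
  have key : ∀ x k, (if c.testBit k then x else x ^^^ (2^L-1)).testBit b = true →
      x.testBit b = c.testBit k := by
    intro x k h
    by_cases hk : c.testBit k = true
    · rw [if_pos hk] at h; rw [h, hk]
    · rw [if_neg hk, Nat.testBit_xor, Nat.testBit_two_pow_sub_one] at h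
      simp [hb] at h
      simp at hk
      rw [h, hk]
  rw [tcol, key _ _ h0, key _ _ h1, key _ _ h2]
  clear h0 h1 h2 key
  interval_cases c <;> decide

theorem xm_testBit {L : ℕ} {pl : List ℕ} {i j r b : ℕ} (hb : b < L)
    (h : (xm L pl i j r).testBit b = true) :
    okd r (tcol pl b j - tcol pl b i).val = true := by
  unfold xm at h
  rcases foldl_lor_testBit (fun t => okd r (t%5))
      (fun t => (cls L pl i (t/5) &&& cls L pl j ((t/5+t%5)%5))) b _ _ h with h | ⟨t, ht, h1, h2⟩
  · simp at h
  · rw [Nat.testBit_and, Bool.and_eq_true] at h2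
    have ht' := List.mem_range.1 ht
    rw [cls_testBit hb (by omega) h2.1, cls_testBit hb (by omega) h2.2]
    have : (Fin.ofNat 5 ((t/5+t%5)%5) - Fin.ofNat 5 (t/5)).val = t % 5 := by
      clear h h1 h2 ht
      interval_cases t <;> decide
    rw [this]; exact h1

structure SInv (N L : ℕ) (pl : List ℕ) (M : ℕ → ℕ → ℕ) (done : List (ℕ × ℕ)) (s : St) : Prop where
  P : ∀ b, s.P.testBit b = true ↔
    ∃ c ∈ done, M c.1 c.2 ≠ 0 ∧ b = 32 * c.2 + 8 * (M c.1 c.2 - 1) + c.1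
  Q : ∀ b, s.Q.testBit b = true → 4 ≤ N ∧ ∃ c ∈ done, ∃ x y, x < 4 ∧ y < 4 ∧
    badT (M c.1 c.2) (x+1) (y+1) = true ∧ b = 128 * c.2 + 32 * y + 8 * x + c.1
  T : ∀ j, s.T.testBit j = true → ∀ i, (i, j) ∈ done → i + 1 < j → M i j = M i (j-1)
  pr : ∀ c, done.getLast? = some c → s.pr = M c.1 c.2
  X : ∀ b, s.X.testBit b = true → b < L ∧ ∀ c ∈ done,
    okd (M c.1 c.2) (tcol pl b c.2 - tcol pl b c.1).val = true

theorem wt_zero (N f i j : ℕ) : wt N f i j 0 = 0 := by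
  have h1 : rNS 0 = 0 := rfl
  have h2 : rK 0 = 0 := rfl
  have h3 : rZ 0 = 0 := rfl
  have h4 : rCode 0 = 0 := rfl
  unfold wt
  simp only [h1, h2, h3, h4, ite_self]
  split_ifs
  · split <;> rfl
  · split <;> rfl

theorem mkC_a (n N L : ℕ) (pl : List ℕ) (c : ℕ × ℕ) {r : ℕ} (hr : r ≤ 4) :
    (mkC n N L pl c).a r = pack (5+5*N) (fun f => wt N f c.1 c.2 r) := by
  interval_cases r
  · change 0 = _
    have : ∀ F, pack F (fun _ => 0) = 0 := by
      intro F; induction F with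
      | zero => rfl
      | succ F ih => rw [pack_succ, ih]; simp
    exact (this _).symm.trans (pack_congr (fun f _ => (wt_zero N f c.1 c.2).symm))
  all_goals rfl

theorem mkC_p (n N L : ℕ) (pl : List ℕ) (c : ℕ × ℕ) {r b : ℕ} (hr : r ≤ 4) :
    ((mkC n N L pl c).p r).testBit b = true ↔ (r ≠ 0 ∧ b = 32 * c.2 + 8 * (r - 1) + c.1) := by
  interval_cases r
  · change (0 : ℕ).testBit b = true ↔ _
    simp
  · change (2 ^ (32 * c.2 + c.1)).testBit b = true ↔ _
    rw [Nat.testBit_two_pow]; simp; omega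
  · change (2 ^ (32 * c.2 + 8 + c.1)).testBit b = true ↔ _
    rw [Nat.testBit_two_pow]; simp; omega
  · change (2 ^ (32 * c.2 + 16 + c.1)).testBit b = true ↔ _
    rw [Nat.testBit_two_pow]; simp; omega
  · change (2 ^ (32 * c.2 + 24 + c.1)).testBit b = true ↔ _
    rw [Nat.testBit_two_pow]; simp; omega

theorem mkC_q (n N L : ℕ) (pl : List ℕ) (c : ℕ × ℕ) {r b : ℕ} (hr : r ≤ 4)
    (h : ((mkC n N L pl c).q r).testBit b = true) : 
    4 ≤ N ∧ ∃ x y, x < 4 ∧ y < 4 ∧ badT r (x+1) (y+1) = true ∧ b = 128*c.2 + 32*y + 8*x + c.1 := by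
  interval_cases r
  · change (0 : ℕ).testBit b = true at h
    simp at h
  all_goals exact qbits_testBit h

theorem mkC_x (n N L : ℕ) (pl : List ℕ) (c : ℕ × ℕ) {r b X : ℕ} (hr : r ≤ 4) (hb : b < L)
    (h : ((mkC n N L pl c).x X r).testBit b = true) :
    okd r (tcol pl b c.2 - tcol pl b c.1).val = true := by
  interval_cases r
  · rfl
  all_goals
    replace h := (Bool.and_eq_true _ _ ▸ (Nat.testBit_and _ _ _ ▸ h :) :)
    exact xm_testBit hb h.2

theorem mkC_x' (n N L : ℕ) (pl : List ℕ) (c : ℕ × ℕ) {r b X : ℕ} (hr : r ≤ 4)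
    (h : ((mkC n N L pl c).x X r).testBit b = true) : X.testBit b = true := by
  interval_cases r
  · exact h
  all_goals
    replace h := (Bool.and_eq_true _ _ ▸ (Nat.testBit_and _ _ _ ▸ h :) :)
    exact h.1

theorem mkC_s (n N L : ℕ) (pl : List ℕ) (c : ℕ × ℕ) {r : ℕ} (hr : r ≤ 4) (h0 : r ≠ 0) :
    (mkC n N L pl c).s r = 128 * c.1 + 32 * (r - 1) := by
  interval_cases r
  · exact absurd rfl h0
  all_goals rfl

theorem newT_eq (T ntb pr r : ℕ) : newT T ntb pr r = if pr = r then T else T &&& ntb := by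
  unfold newT
  cases h : Nat.beq pr r
  · rw [if_neg]; rfl
    intro h2; rw [← Nat.beq_eq, h] at h2; simp at h2
  · rw [if_pos (by rw [← Nat.beq_eq]; exact h)]

theorem SInv.step {n N L : ℕ} {pl : List ℕ} {M : ℕ → ℕ → ℕ} {done : List (ℕ × ℕ)} {s : St}
    (h : SInv N L pl M done s) (c : ℕ × ℕ) (h4 : M c.1 c.2 ≤ 4) (hN : c.2 < N)
    (hc : c.2 = c.1 + 1 ∨ done.getLast? = some (c.1, c.2 - 1)) :
    SInv N L pl M (done ++ [c]) (stp (mkC n N L pl c) (M c.1 c.2) s) := by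
  constructor
  · intro b
    change (s.P ||| _).testBit b = true ↔ _
    rw [Nat.testBit_or, Bool.or_eq_true, h.P, mkC_p _ _ _ _ _ h4]
    simp only [List.mem_append, List.mem_singleton, or_and_right, exists_or, exists_eq_left]
  · intro b hb
    change (s.Q ||| _).testBit b = true at hb
    rw [Nat.testBit_or, Bool.or_eq_true] at hb
    rcases hb with hb | hb
    · obtain ⟨h1, c', hc', h2⟩ := h.Q b hb
      exact ⟨h1, c', by simp [hc'], h2⟩
    · obtain ⟨h1, h2⟩ := mkC_q _ _ _ _ _ h4 hb
      exact ⟨h1, c, by simp, h2⟩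
  · intro j hj i hi hij
    change (newT s.T (2^N - 1 - 2^c.2) s.pr (M c.1 c.2)).testBit j = true at hj
    rw [newT_eq] at hj
    have hT : s.T.testBit j = true := by
      split_ifs at hj
      · exact hj
      · rw [Nat.testBit_and, Bool.and_eq_true] at hj; exact hj.1
    rw [List.mem_append, List.mem_singleton] at hi
    rcases hi with hi | hi
    · exact h.T j hT i hi hij
    · subst hi
      simp only at hc hj hN h4
      rcases hc with hc | hc
      · omega
      · have h1 := h.pr _ hc
        simp only at h1
        split_ifs at hj with h2
        · rw [← h2, h1]
        · rw [Nat.testBit_and, Bool.and_eq_true] at hj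
          have hj2 := hj.2
          exfalso
          have e : 2^N - 1 - 2^j = 2^N - (2^j + 1) := by omega
          rw [e, Nat.testBit_two_pow_sub_succ (Nat.pow_lt_pow_right (by norm_num) hN)] at hj2
          simp [Nat.testBit_two_pow_self] at hj2
  · intro c' hc'
    rw [List.getLast?_append] at hc'
    simp at hc'
    subst hc'
    rfl
  · intro b hb
    change ((mkC n N L pl c).x s.X (M c.1 c.2)).testBit b = true at hb
    obtain ⟨h1, h2⟩ := h.X b (mkC_x' _ _ _ _ _ h4 hb)
    refine ⟨h1, ?_⟩
    intro c' hc'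
    rw [List.mem_append, List.mem_singleton] at hc'
    rcases hc' with hc' | hc'
    · exact h2 c' hc'
    · subst hc'
      exact mkC_x _ _ _ _ _ h4 h1 hb

/-- value of field `f` after processing the cells in `done` -/
def fv (N : ℕ) (M : ℕ → ℕ → ℕ) (x0 : ℕ → ℕ) (done : List (ℕ × ℕ)) (f : ℕ) : ℕ :=
  x0 f + (done.map (fun c => wt N f c.1 c.2 (M c.1 c.2))).sum

/-- the local rules used by the search -/
structure LocalRules (n N : ℕ) (M : ℕ → ℕ → ℕ) : Prop where
  N8 : N ≤ 8
  le4 : ∀ i j, M i j ≤ 4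
  top : ∀ i j, i < j → j < N → M i j ≤ topR n N i
  tie : ∀ i j, i + 1 < j → j < N → (∀ i' < i, M i' j = M i' (j-1)) → M i j ≤ M i (j-1)
  tri : 4 ≤ N → ∀ i j k, i < j → j < k → k < N → badT (M i j) (M i k) (M j k) = false

structure CellOK (N : ℕ) (M : ℕ → ℕ → ℕ) (x0 : ℕ → ℕ) (pre : List (ℕ × ℕ)) (c : ℕ × ℕ) : Prop where
  c1 : c.1 < c.2
  c2 : c.2 < N
  hc : c.2 = c.1 + 1 ∨ pre.getLast? = some (c.1, c.2 - 1)
  hpre : ∀ i < c.1, (i, c.2) ∈ pre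
  hpos : ∀ d ∈ pre, d.1 < d.2 ∧ d.2 < N
  fB : ∀ f < 5 + 5*N, fv N M x0 (pre ++ [c]) f < B24
  fLe : ∀ f < 5 + 5*N, tLe N f c.1 = true → fv N M x0 (pre ++ [c]) f < G23
  fGe : ∀ f < 5 + 5*N, tGe N f c.1 c.2 = true → G23 ≤ fv N M x0 (pre ++ [c]) f

theorem fv_snoc (N : ℕ) (M : ℕ → ℕ → ℕ) (x0 : ℕ → ℕ) (done : List (ℕ × ℕ)) (c : ℕ × ℕ) (f : ℕ) :
    fv N M x0 (done ++ [c]) f = fv N M x0 done f + wt N f c.1 c.2 (M c.1 c.2) := by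
  simp [fv, add_assoc]

theorem okC_of {n N L : ℕ} {pl : List ℕ} {M : ℕ → ℕ → ℕ} {x0 : ℕ → ℕ} {done : List (ℕ × ℕ)} {s : St}
    {c : ℕ × ℕ} (LR : LocalRules n N M) (hI : SInv N L pl M done s)
    (hA : s.A = pack (5+5*N) (fv N M x0 done)) (hC : CellOK N M x0 done c) :
    OkC (mkC n N L pl c) (M c.1 c.2) s := by
  have h4 := LR.le4 c.1 c.2
  have hN := LR.N8
  constructor
  · exact h4
  · change M c.1 c.2 ≤ if Nat.land s.T (if c.2 = c.1 + 1 then 0 else 2 ^ c.2) = 0 then topR n N c.1 else s.pr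
    split_ifs with h1 h2 h2
    · exact LR.top _ _ hC.c1 hC.c2
    · exact absurd (Nat.and_zero _) h2
    · exact LR.top _ _ hC.c1 hC.c2
    · have hT : s.T.testBit c.2 = true := by
        by_contra h3
        apply h2
        change s.T &&& 2 ^ c.2 = 0
        rw [Nat.and_two_pow]
        simp at h3
        simp [h3]
      have h5 : done.getLast? = some (c.1, c.2 - 1) := by
        rcases hC.hc with h | h
        · exact absurd h h1
        · exact h
      rw [hI.pr _ h5]
      have hc1 := hC.c1
      refine LR.tie _ _ (by omega) hC.c2 ?_
      intro i' hi'
      exact hI.T _ hT _ (hC.hpre _ hi') (by omega)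
  · rw [mkC_a _ _ _ _ _ h4, hA, pack_add]
    change Nat.land _ (pack _ _) = pack _ _
    have hB : ∀ f < 5 + 5*N, fv N M x0 done f + wt N f c.1 c.2 (M c.1 c.2) < B24 := by
      intro f hf
      rw [← fv_snoc]; exact hC.fB f hf
    rw [pack_land hB (by intro f _; split_ifs <;> decide)]
    apply pack_congr
    intro f hf
    have h1 := hC.fB f hf
    have h2 := hC.fLe f hf
    have h3 := hC.fGe f hf
    rw [fv_snoc] at h1 h2 h3
    by_cases hg : tGe N f c.1 c.2 = true
    · simp only [hg, Bool.or_true, if_true]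
      exact land_G23_ge (h3 hg) h1
    · by_cases hl : tLe N f c.1 = true
      · simp only [hl, Bool.true_or, if_true, hg]
        exact land_G23_lt (h2 hl)
      · simp only [hl, hg, Bool.or_self]
        exact Nat.and_zero _
  · intro h0
    rw [mkC_s _ _ _ _ _ h4 h0]
    change (s.Q >>> _) &&& ((s.P >>> (32 * c.2)) &&& (2 ^ 32 - 1)) = 0
    apply Nat.eq_of_testBit_eq
    intro t
    rw [Nat.zero_testBit]
    by_contra hb
    rw [Bool.not_eq_false, Nat.testBit_and, Nat.testBit_and, Nat.testBit_shiftRight,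
      Nat.testBit_shiftRight, Nat.testBit_two_pow_sub_one, Bool.and_eq_true, Bool.and_eq_true,
      decide_eq_true_eq] at hb
    obtain ⟨hq, hp, ht⟩ := hb
    obtain ⟨⟨i1, j1⟩, hd1, hm1, he1⟩ := (hI.P _).1 hp
    obtain ⟨hN4, ⟨i2, j2⟩, hd2, x, y, hx, hy, hbad, he2⟩ := hI.Q _ hq
    simp only at hm1 he1 hbad he2
    have p1 := hC.hpos _ hd1
    have p2 := hC.hpos _ hd2
    simp only at p1 p2
    have hM1 := LR.le4 i1 j1
    have ej : j1 = c.2 := by omega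
    have et : t = 8 * (M i1 j1 - 1) + i1 := by omega
    have ej2 : j2 = c.1 := by omega
    have ei2 : i2 = i1 := by omega
    have ex : x + 1 = M i1 j1 := by omega
    have ey : y + 1 = M c.1 c.2 := by omega
    subst ej ej2 ei2
    rw [ex, ey] at hbad
    rw [LR.tri hN4 i2 c.1 c.2 (by omega) hC.c1 (by omega)] at hbad
    simp at hbad

theorem phase_sound {n N L : ℕ} {pl : List ℕ} {M : ℕ → ℕ → ℕ} {x0 : ℕ → ℕ} {k : KT}
    (LR : LocalRules n N M) : ∀ (rest done : List (ℕ × ℕ)) (s : St), SInv N L pl M done s →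
    s.A = pack (5+5*N) (fv N M x0 done) →
    (srch (rest.map (mkC n N L pl)) k).run s = true →
    (∀ pre c post, rest = pre ++ c :: post → CellOK N M x0 (done ++ pre) c) →
    ∃ s', k.run s' = true ∧ SInv N L pl M (done ++ rest) s' ∧
      s'.A = pack (5+5*N) (fv N M x0 (done ++ rest)) := by
  intro rest
  induction rest with
  | nil =>
    intro done s hI hA h _
    exact ⟨s, h, by simpa using hI, by simpa using hA⟩
  | cons c rest ih =>
    intro done s hI hA h H
    have hC : CellOK N M x0 done c := by simpa using H [] c rest rfl
    have ok := okC_of (L := L) (pl := pl) LR hI hA hC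
    rw [List.map_cons, srch_cons] at h
    have h1 := stepC_sound h ok
    have h4 := LR.le4 c.1 c.2
    have hI' : SInv N L pl M (done ++ [c]) (stp (mkC n N L pl c) (M c.1 c.2) s) :=
      hI.step c h4 hC.c2 hC.hc
    obtain ⟨s', h2, h3, h5⟩ := ih (done ++ [c]) _ hI' (by
      change s.A + _ = _
      rw [mkC_a _ _ _ _ _ h4, hA, pack_add]
      apply pack_congr
      intro f _
      rw [fv_snoc]) h1 (by
      intro pre d post he
      have := H (c :: pre) d post (by rw [he]; rfl)
      simpa using this)
    exact ⟨s', h2, by simpa using h3, by simpa using h5⟩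

def cellsAll (N : ℕ) : List (ℕ × ℕ) := cellsA N ++ cellsB N

theorem mem_cellsAll {N : ℕ} {c : ℕ × ℕ} : c ∈ cellsAll N ↔ c.1 < c.2 ∧ c.2 < N := by
  obtain ⟨i, j⟩ := c
  simp only [cellsAll, cellsA, cellsB, List.mem_append, List.mem_map, List.mem_range,
    List.mem_flatMap, Prod.mk.injEq]
  constructor
  · rintro (⟨a, ha, h1, h2⟩ | ⟨a, ha, b, hb, h1, h2⟩) <;> omega
  · rintro ⟨h1, h2⟩
    rcases Nat.eq_zero_or_pos i with h | h
    · exact Or.inl ⟨j - 1, by omega, by omega, by omega⟩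
    · exact Or.inr ⟨i - 1, by omega, j - i - 1, by omega, by omega, by omega⟩

/-- row-major order -/
def lexlt (a b : ℕ × ℕ) : Prop := a.1 < b.1 ∨ (a.1 = b.1 ∧ a.2 < b.2)
def nextRel (a b : ℕ × ℕ) : Prop := b.2 = b.1 + 1 ∨ a = (b.1, b.2 - 1)
instance : DecidableRel lexlt := fun a b => by unfold lexlt; infer_instance
instance : DecidableRel nextRel := fun a b => by unfold nextRel; infer_instance

theorem cellsAll_pairwise {N : ℕ} (h3 : 3 ≤ N) (h8 : N ≤ 8) : (cellsAll N).Pairwise lexlt := by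
  interval_cases N <;> decide

theorem cellsAll_chain {N : ℕ} (h3 : 3 ≤ N) (h8 : N ≤ 8) :
    ((0,0) :: cellsAll N).IsChain nextRel := by
  interval_cases N <;> decide

theorem cellsAll_length {N : ℕ} (h3 : 3 ≤ N) (h8 : N ≤ 8) : (cellsAll N).length ≤ 28 := by
  interval_cases N <;> decide

theorem cellsAll_nodup {N : ℕ} (h3 : 3 ≤ N) (h8 : N ≤ 8) : (cellsAll N).Nodup := by
  refine (cellsAll_pairwise h3 h8).imp ?_
  rintro ⟨a, b⟩ ⟨c, d⟩ h e
  rw [Prod.mk.injEq] at e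
  simp only [lexlt] at h
  omega

theorem sum_cells {N : ℕ} (h3 : 3 ≤ N) (h8 : N ≤ 8) (g : ℕ × ℕ → ℕ) :
    ((cellsAll N).map g).sum =
      ∑ i ∈ Finset.range N, ∑ j ∈ Finset.range N, if i < j then g (i, j) else 0 := by
  rw [← List.sum_toFinset _ (cellsAll_nodup h3 h8), ← Finset.sum_product', ← Finset.sum_filter]
  apply Finset.sum_congr _ (fun _ _ => rfl)
  ext c
  simp only [List.mem_toFinset, mem_cellsAll, Finset.mem_filter, Finset.mem_product, Finset.mem_range]
  omega

/-- row sums -/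
def rowS (N : ℕ) (M : ℕ → ℕ → ℕ) (φ : ℕ → ℕ) (v : ℕ) : ℕ := ∑ u ∈ Finset.range N, φ (M v u)

structure Good (n N : ℕ) (M : ℕ → ℕ → ℕ) : Prop extends LocalRules n N M where
  N3 : 3 ≤ N
  n18 : n ≤ 18
  sym : ∀ i j, M i j = M j i
  diag : ∀ i, M i i = 0
  sumNS : ∑ v ∈ Finset.range N, rowS N M rNS v = 2 * (N + (n-2)/4)
  sumK : ∑ v ∈ Finset.range N, rowS N M rK v = 2 * (n - N)
  deg3 : ∀ v < N, 3 ≤ rowS N M rNS v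
  z5 : ∀ v < N, 5 ≤ rowS N M rZ v
  code : ∀ v < N, rowS N M rCode v ≤ rowS N M rCode 0
  cross : ∀ v, v + 1 < N → ∃ i j, i ≤ v ∧ v < j ∧ j < N ∧ M i j ≠ 0

section totals
variable {n N : ℕ} {M : ℕ → ℕ → ℕ}

theorem tot_vertex (h3 : 3 ≤ N) (h8 : N ≤ 8) (sym : ∀ i j, M i j = M j i) (diag : ∀ i, M i i = 0)
    (φ : ℕ → ℕ) (h0 : φ 0 = 0) {v : ℕ} (hv : v < N) :
    ((cellsAll N).map (fun c => if v = c.1 ∨ v = c.2 then φ (M c.1 c.2) else 0)).sum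
      = rowS N M φ v := by
  rw [sum_cells h3 h8]
  have e : ∀ i j, (if i < j then (if v = i ∨ v = j then φ (M i j) else 0) else 0)
      = (if i = v then (if v < j then φ (M v j) else 0) else 0)
        + (if j = v then (if i < v then φ (M v i) else 0) else 0) := by
    intro i j
    by_cases h1 : i = v
    · subst h1
      by_cases h2 : j = i
      · subst h2; simp
      · simp [h2]
    · by_cases h2 : j = v
      · subst h2
        simp [h1, sym j i]
      · simp [h1, h2, Ne.symm h1, Ne.symm h2]
  simp only [e, Finset.sum_add_distrib]
  rw [Finset.sum_comm]
  have e1 : ∑ y ∈ Finset.range N, ∑ x ∈ Finset.range N, (if x = v then (if v < y then φ (M v y) else 0) else 0)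
     = ∑ y ∈ Finset.range N, if v < y then φ (M v y) else 0 := by
    apply Finset.sum_congr rfl
    intro y _
    rw [Finset.sum_ite_eq']; simp [hv]
  have e2 : ∑ x ∈ Finset.range N, ∑ y ∈ Finset.range N, (if y = v then (if x < v then φ (M v x) else 0) else 0)
     = ∑ x ∈ Finset.range N, if x < v then φ (M v x) else 0 := by
    apply Finset.sum_congr rfl
    intro y _
    rw [Finset.sum_ite_eq']; simp [hv]
  rw [e1, e2, ← Finset.sum_add_distrib]
  apply Finset.sum_congr rfl
  intro u _
  rcases lt_trichotomy u v with h | h | h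
  · simp [h, not_lt_of_gt h]
  · subst h; simp [diag, h0]
  · simp [h, not_lt_of_gt h]

theorem tot_prefix (h3 : 3 ≤ N) (h8 : N ≤ 8) (sym : ∀ i j, M i j = M j i) (diag : ∀ i, M i i = 0)
    (φ : ℕ → ℕ) (h0 : φ 0 = 0) {v : ℕ} (hv : v < N) :
    ((cellsAll N).map (fun c => (if c.1 ≤ v then φ (M c.1 c.2) else 0)
      + (if c.2 ≤ v then φ (M c.1 c.2) else 0))).sum
      = ∑ k ∈ Finset.range (v+1), rowS N M φ k := by
  have : ∑ k ∈ Finset.range (v+1), rowS N M φ k = ∑ k ∈ Finset.range (v+1),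
      ((cellsAll N).map (fun c => if k = c.1 ∨ k = c.2 then φ (M c.1 c.2) else 0)).sum := by
    apply Finset.sum_congr rfl
    intro k hk
    rw [tot_vertex h3 h8 sym diag φ h0 (by rw [Finset.mem_range] at hk; omega)]
  rw [this]
  simp only [← List.sum_toFinset _ (cellsAll_nodup h3 h8)]
  rw [Finset.sum_comm]
  apply Finset.sum_congr rfl
  rintro ⟨i, j⟩ hc
  rw [List.mem_toFinset, mem_cellsAll] at hc
  simp only at hc ⊢
  have e : ∀ k, (if k = i ∨ k = j then φ (M i j) else 0)
      = (if k = i then φ (M i j) else 0) + (if k = j then φ (M i j) else 0) := by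
    intro k
    by_cases h1 : k = i
    · have : k ≠ j := by omega
      simp [h1, show i ≠ j by omega]
    · simp [h1]
  simp only [e, Finset.sum_add_distrib, Finset.sum_ite_eq', Finset.mem_range, Nat.lt_succ_iff]

theorem tot_all (h3 : 3 ≤ N) (h8 : N ≤ 8) (sym : ∀ i j, M i j = M j i) (diag : ∀ i, M i i = 0)
    (φ : ℕ → ℕ) (h0 : φ 0 = 0) :
    2 * ((cellsAll N).map (fun c => φ (M c.1 c.2))).sum = ∑ k ∈ Finset.range N, rowS N M φ k := by
  have h := tot_prefix h3 h8 sym diag φ h0 (v := N - 1) (by omega)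
  rw [show N - 1 + 1 = N by omega] at h
  rw [← h, ← List.sum_map_mul_left]
  congr 1
  apply List.map_congr_left
  intro c hc
  rw [mem_cellsAll] at hc
  rw [if_pos (by omega), if_pos (by omega)]
  ring

end totals

theorem wt_le (N f i j : ℕ) {r : ℕ} (hr : r ≤ 4) (hij : i < j) : wt N f i j r ≤ 135168 := by
  have h1 : rNS r ≤ 2 := by interval_cases r <;> decide
  have h2 : rK r ≤ 3 := by interval_cases r <;> decide
  have h3 : rZ r ≤ 3 := by interval_cases r <;> decide
  have h4 : rCode r ≤ 135168 := by interval_cases r <;> decide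
  unfold wt
  simp only
  split_ifs
  · split <;> omega
  all_goals (split <;> omega)

section run
variable {n N : ℕ} {M : ℕ → ℕ → ℕ}

/-- total weight of a field -/
def totW (N : ℕ) (M : ℕ → ℕ → ℕ) (f : ℕ) : ℕ :=
  ((cellsAll N).map (fun c => wt N f c.1 c.2 (M c.1 c.2))).sum

theorem list_sum_map_congr {α : Type*} {l : List α} {f g : α → ℕ} (h : ∀ a ∈ l, f a = g a) :
    (l.map f).sum = (l.map g).sum := by
  rw [List.map_congr_left h]

theorem Good.tE (h : Good n N M) :
    ((cellsAll N).map (fun c => rNS (M c.1 c.2))).sum = N + (n-2)/4 := by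
  have := tot_all h.N3 h.N8 h.sym h.diag rNS rfl
  rw [h.sumNS] at this
  omega

theorem Good.tK (h : Good n N M) :
    ((cellsAll N).map (fun c => rK (M c.1 c.2))).sum = n - N := by
  have := tot_all h.N3 h.N8 h.sym h.diag rK rfl
  rw [h.sumK] at this
  omega

theorem Good.t2 (h : Good n N M) :
    ((cellsAll N).map (fun c => 2 * rNS (M c.1 c.2) - rK (M c.1 c.2))).sum + (n - N)
      = 2 * (N + (n-2)/4) := by
  rw [← h.tK, ← h.tE, ← List.sum_map_mul_left, ← List.sum_map_add]
  apply list_sum_map_congr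
  intro c _
  have h4 := h.le4 c.1 c.2
  generalize M c.1 c.2 = r at *
  interval_cases r <;> rfl

theorem Good.exN (h : Good n N M) : 3 * N ≤ 2 * (N + (n-2)/4) := by
  rw [← h.sumNS]
  calc 3 * N = ∑ v ∈ Finset.range N, 3 := by simp [mul_comm]
    _ ≤ _ := Finset.sum_le_sum (fun v hv => h.deg3 v (Finset.mem_range.1 hv))

theorem Good.deg0 (h : Good n N M) : (2 * (N + (n-2)/4) + N - 1) / N ≤ rowS N M rNS 0 := by
  have low : ∀ v, ∃ l, l < 65536 ∧ rowS N M rCode v = 65536 * rowS N M rNS v + l := by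
    intro v
    refine ⟨∑ u ∈ Finset.range N, [0,1,16,256,4096].getD (M v u) 0, ?_, ?_⟩
    · have : ∑ u ∈ Finset.range N, [0,1,16,256,4096].getD (M v u) 0 ≤ ∑ u ∈ Finset.range N, 4096 := by
        apply Finset.sum_le_sum
        intro u _
        have h4 := h.le4 v u
        generalize M v u = r at *
        interval_cases r <;> decide
      have h8 := h.N8
      rw [Finset.sum_const, Finset.card_range, smul_eq_mul] at this
      omega
    · unfold rowS
      rw [Finset.mul_sum, ← Finset.sum_add_distrib]
      apply Finset.sum_congr rfl
      intro u _
      have h4 := h.le4 v u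
      generalize M v u = r at *
      interval_cases r <;> decide
  have mx : ∀ v < N, rowS N M rNS v ≤ rowS N M rNS 0 := by
    intro v hv
    obtain ⟨l, hl, e⟩ := low v
    obtain ⟨l', hl', e'⟩ := low 0
    have := h.code v hv
    omega
  have hs : 2 * (N + (n-2)/4) ≤ N * rowS N M rNS 0 := by
    rw [← h.sumNS]
    calc _ ≤ ∑ v ∈ Finset.range N, rowS N M rNS 0 :=
          Finset.sum_le_sum (fun v hv => mx v (Finset.mem_range.1 hv))
      _ = _ := by simp
  have h3 := h.N3
  rw [← Nat.lt_succ_iff, Nat.div_lt_iff_lt_mul (by omega)]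
  have e : (rowS N M rNS 0).succ * N = N * rowS N M rNS 0 + N := by
    rw [Nat.succ_mul, mul_comm]
  omega

theorem field_cases {N f : ℕ} (hN : 0 < N) (hf : f < 5 + 5 * N) :
    f < 5 ∨ ∃ k v, v < N ∧ k < 5 ∧ ¬ f < 5 ∧ (f - 5) / N = k ∧ (f - 5) % N = v := by
  by_cases h : f < 5
  · exact Or.inl h
  · refine Or.inr ⟨_, _, Nat.mod_lt (f - 5) hN, ?_, h, rfl, rfl⟩
    rw [Nat.div_lt_iff_lt_mul hN]
    omega

theorem Good.pref (h : Good n N M) {v : ℕ} (hv : v < N) :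
    ∑ k ∈ Finset.range (v+1), rowS N M rNS k ≤ 3 * (v+1) + (2 * (N + (n-2)/4) - 3 * N) := by
  have h1 : ∑ k ∈ Finset.range N, rowS N M rNS k = ∑ k ∈ Finset.range (v+1), rowS N M rNS k
      + ∑ k ∈ Finset.Ico (v+1) N, rowS N M rNS k := by
    rw [Finset.sum_range_add_sum_Ico _ (by omega)]
  have h2 : ∑ k ∈ Finset.Ico (v+1) N, 3 ≤ ∑ k ∈ Finset.Ico (v+1) N, rowS N M rNS k := by
    apply Finset.sum_le_sum
    intro k hk
    rw [Finset.mem_Ico] at hk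
    exact h.deg3 k hk.2
  simp at h2
  rw [h.sumNS] at h1
  have := h.exN
  omega

theorem Good.leTot (h : Good n N M) {D i f : ℕ} (hf : f < 5 + 5 * N)
    (hD : 0 < i → D + rowS N M rCode 0 < G23)
    (ht : tLe N f i = true) :
    initF n N f + (if 5 ≤ f ∧ (f - 5) / N = 3 then D else 0) + totW N M f < G23 := by
  have h3 := h.N3
  have hG : G23 = 8388608 := rfl
  have hn := h.n18
  have h8 := h.N8
  rcases field_cases (by omega) hf with h5 | ⟨k, v, hv, hk, h5, ek, ev⟩
  · have e0 : ¬ (5 ≤ f ∧ (f - 5) / N = 3) := by omega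
    rw [if_neg e0]
    simp only [tLe, if_pos h5, decide_eq_true_eq] at ht
    have hE := h.tE
    have hK := h.tK
    have h2 := h.t2
    interval_cases f
    · simp only [totW, wt, initF, if_pos h5, hE]; omega
    · simp only [totW, wt, initF, if_pos h5, hK]; omega
    · simp only [totW, wt, initF, if_pos h5]; omega
  · simp only [tLe, if_neg h5, ek] at ht
    simp only [totW, wt, initF, if_neg h5, ek, ev]
    interval_cases k
    · simp at ht
    · simp at ht
    · simp only [show ¬ (5 ≤ f ∧ 2 = 3) by omega, if_false]
      have := tot_prefix h.N3 h.N8 h.sym h.diag rNS rfl hv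
      rw [this]
      have := h.pref hv
      omega
    · rw [if_pos (show (5 ≤ f ∧ 3 = 3) by omega)]
      simp only
      rw [tot_vertex h.N3 h.N8 h.sym h.diag rCode rfl hv]
      have := h.code v hv
      have := hD (by simpa using ht)
      omega
    · simp at ht

theorem Good.geTot (h : Good n N M) {i j f : ℕ} (hij : i < j) (hf : f < 5 + 5 * N)
    (ht : tGe N f i j = true) :
    G23 ≤ initF n N f + totW N M f := by
  have h3 := h.N3
  have hG : G23 = 8388608 := rfl
  have hn := h.n18
  have h8 := h.N8
  have hj : j + 1 = N := by
    by_contra hj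
    simp [tGe, hj] at ht
  simp only [tGe, if_pos hj] at ht
  rcases field_cases (by omega) hf with h5 | ⟨k, v, hv, hk, h5, ek, ev⟩
  · simp only [if_pos h5, Bool.and_eq_true, decide_eq_true_eq] at ht
    have hE := h.tE
    have hK := h.tK
    obtain ⟨h1, h2⟩ := ht
    interval_cases f
    · simp only [totW, wt, initF, if_pos h5, hE]; omega
    · simp only [totW, wt, initF, if_pos h5, hK]; omega
  · simp only [if_neg h5, ek, ev] at ht
    simp only [totW, wt, initF, if_neg h5, ek, ev]
    interval_cases k
    · simp only
      rw [tot_vertex h.N3 h.N8 h.sym h.diag rNS rfl hv]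
      split_ifs with hv0
      · subst hv0
        have := h.deg0
        omega
      · have := h.deg3 v hv
        omega
    · simp only
      rw [tot_vertex h.N3 h.N8 h.sym h.diag rZ rfl hv]
      have := h.z5 v hv
      omega
    · simp at ht
    · simp at ht
    · simp only [decide_eq_true_eq] at ht ⊢
      obtain ⟨a, b, ha, hb, hbN, hne⟩ := h.cross v (by omega)
      have hmem : (a, b) ∈ cellsAll N := by rw [mem_cellsAll]; simp only; omega
      have h1 := List.single_le_sum (l := (cellsAll N).map
        (fun c => if c.1 ≤ v ∧ v < c.2 then rNS (M c.1 c.2) else 0)) (by simp) _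
        (List.mem_map.2 ⟨(a, b), hmem, rfl⟩)
      simp only [if_pos (And.intro ha hb)] at h1
      have h4 := h.le4 a b
      have h5 : 1 ≤ rNS (M a b) := by
        generalize M a b = r at *
        interval_cases r
        · omega
        all_goals decide
      omega

theorem fv_split {x0 : ℕ → ℕ} {pre post : List (ℕ × ℕ)} {c : ℕ × ℕ}
    (hs : cellsAll N = pre ++ c :: post) (f : ℕ) :
    fv N M x0 (pre ++ [c]) f + (post.map (fun c => wt N f c.1 c.2 (M c.1 c.2))).sum
      = x0 f + totW N M f := by
  simp [fv, totW, hs, add_assoc]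

theorem post_zero {f : ℕ} {post : List (ℕ × ℕ)} {c : ℕ × ℕ}
    (hf : f < 5 + 5 * N) (ht : tGe N f c.1 c.2 = true) (h3 : 3 ≤ N)
    (hp : ∀ d ∈ post, lexlt c d ∧ d.1 < d.2 ∧ d.2 < N) :
    (post.map (fun c => wt N f c.1 c.2 (M c.1 c.2))).sum = 0 := by
  apply List.sum_eq_zero
  intro x hx
  obtain ⟨d, hd, rfl⟩ := List.mem_map.1 hx
  obtain ⟨h1, h2, h4⟩ := hp d hd
  unfold lexlt at h1
  have hj : c.2 + 1 = N := by
    by_contra hj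
    simp [tGe, hj] at ht
  simp only [tGe, if_pos hj] at ht
  rcases field_cases (by omega) hf with h5 | ⟨k, v, hv, hk, h5, ek, ev⟩
  · simp only [if_pos h5, Bool.and_eq_true, decide_eq_true_eq] at ht
    omega
  · simp only [if_neg h5, ek, ev] at ht
    simp only [wt, if_neg h5, ek, ev]
    interval_cases k
    · simp only [Bool.or_eq_true, Bool.and_eq_true, decide_eq_true_eq] at ht ⊢
      rw [if_neg (by omega)]
    · simp only [Bool.or_eq_true, Bool.and_eq_true, decide_eq_true_eq] at ht ⊢
      rw [if_neg (by omega)]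
    · simp at ht
    · simp at ht
    · simp only [decide_eq_true_eq] at ht ⊢
      rw [if_neg (by omega)]

theorem init_le (h3 : 3 ≤ N) {f : ℕ} (n : ℕ) (hn : n ≤ 18) (hN : N ≤ 8) : initF n N f ≤ G23 + 18 := by
  have hG : G23 = 8388608 := rfl
  unfold initF
  simp only
  split_ifs
  · split <;> omega
  all_goals (split <;> first | omega | exact le_trans (Nat.sub_le _ _) (by omega))

/-- initial field values, with an offset in the code fields -/
def x0D (n N D : ℕ) (f : ℕ) : ℕ := initF n N f + (if 5 ≤ f ∧ (f - 5) / N = 3 then D else 0)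

theorem sum_wt_le (h : Good n N M) (f : ℕ) (l : List (ℕ × ℕ)) (hl : ∀ c ∈ l, c.1 < c.2) :
    (l.map (fun c => wt N f c.1 c.2 (M c.1 c.2))).sum ≤ l.length * 135168 := by
  have := List.sum_le_card_nsmul (l.map (fun c => wt N f c.1 c.2 (M c.1 c.2))) 135168 (by
    intro x hx
    obtain ⟨d, hd, rfl⟩ := List.mem_map.1 hx
    exact wt_le N f d.1 d.2 (h.le4 _ _) (hl d hd))
  simpa using this

theorem x0D_le (h : Good n N M) {D : ℕ} (hD : D < G23) (f : ℕ) : x0D n N D f ≤ G23 + 18 := by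
  have hG : G23 = 8388608 := rfl
  unfold x0D
  by_cases hf : 5 ≤ f ∧ (f - 5) / N = 3
  · rw [if_pos hf]
    have : initF n N f = 0 := by
      simp [initF, show ¬ f < 5 by omega, hf.2]
    omega
  · rw [if_neg hf]
    exact init_le h.N3 n h.n18 h.N8

theorem Good.fB (h : Good n N M) {D : ℕ} (hD : D < G23) (f : ℕ) (l : List (ℕ × ℕ))
    (hl : ∀ c ∈ l, c.1 < c.2) (hlen : l.length ≤ 28) : fv N M (x0D n N D) l f < B24 := by
  have h1 := sum_wt_le h f l hl
  have h2 := x0D_le h hD f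
  have hG : G23 = 8388608 := rfl
  have hB : B24 = 16777216 := rfl
  unfold fv
  omega

theorem Good.cellOK (h : Good n N M) {D : ℕ} (hDG : D < G23) {pre post : List (ℕ × ℕ)} {c : ℕ × ℕ}
    (hs : cellsAll N = pre ++ c :: post)
    (hD : 0 < c.1 → D + rowS N M rCode 0 < G23) :
    CellOK N M (x0D n N D) pre c := by
  have hc : c ∈ cellsAll N := by rw [hs]; simp
  have hpre : ∀ d ∈ pre, d ∈ cellsAll N := by intro d hd; rw [hs]; simp [hd]
  have hpost : ∀ d ∈ post, d ∈ cellsAll N := by intro d hd; rw [hs]; simp [hd]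
  have hpw := cellsAll_pairwise h.N3 h.N8
  have hch := cellsAll_chain h.N3 h.N8
  have hlen := cellsAll_length h.N3 h.N8
  have hcm := mem_cellsAll.1 hc
  rw [hs] at hpw hch hlen
  have hpost2 : ∀ d ∈ post, lexlt c d := by
    rw [List.pairwise_append, List.pairwise_cons] at hpw
    exact hpw.2.1.1
  constructor
  · exact hcm.1
  · exact hcm.2
  · by_cases hp : pre = []
    · subst hp
      simp only [List.nil_append, List.isChain_cons_cons] at hch
      rcases hch.1 with h1 | h1
      · exact Or.inl h1
      · left
        rw [Prod.mk.injEq] at h1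
        have := hcm.1
        omega
    · obtain ⟨p, d, rfl⟩ := List.eq_nil_or_concat pre |>.resolve_left hp
      have : nextRel d c := by
        have h2 : ((0, 0) :: ((p ++ [d]) ++ c :: post)) = ((0,0) :: p) ++ d :: c :: post := by simp
        rw [List.concat_eq_append] at hch
        rw [h2, List.isChain_append] at hch
        have := hch.2.1
        rw [List.isChain_cons_cons] at this
        exact this.1
      rcases this with h1 | h1
      · exact Or.inl h1
      · right
        simp [h1]
  · intro i hi
    have hm : (i, c.2) ∈ cellsAll N := by rw [mem_cellsAll]; simp only; omega
    rw [hs, List.mem_append, List.mem_cons] at hm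
    rcases hm with h1 | h1 | h1
    · exact h1
    · rw [← h1] at hi; simp at hi
    · have := hpost2 _ h1
      simp only [lexlt] at this
      omega
  · intro d hd
    exact mem_cellsAll.1 (hpre d hd)
  · intro f hf
    apply h.fB hDG
    · intro d hd
      rw [List.mem_append, List.mem_singleton] at hd
      rcases hd with hd | rfl
      · exact (mem_cellsAll.1 (hpre d hd)).1
      · exact hcm.1
    · simp at hlen ⊢
      omega
  · intro f hf ht
    have h1 := fv_split (M := M) (x0 := x0D n N D) hs f
    have h2 := h.leTot hf hD ht
    unfold x0D at h1 ⊢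
    omega
  · intro f hf ht
    have h1 := fv_split (M := M) (x0 := x0D n N D) hs f
    have h2 := h.geTot hcm.1 hf ht
    have h3 := post_zero (M := M) (post := post) hf ht h.N3
      (fun d hd => ⟨hpost2 d hd, mem_cellsAll.1 (hpost d hd)⟩)
    rw [h3] at h1
    have : initF n N f ≤ x0D n N D f := by unfold x0D; omega
    omega
end run

theorem leaf_sound {exc : List ℕ} {s : St} (h : (leaf exc).run s = true) : s.X ≠ 0 ∨ s.P ∈ exc := by
  by_cases hX : s.X = 0
  · right
    have e : (leaf exc).run s
        = (List.rec false (fun e _ ih => Bool.rec ih true (Nat.beq s.P e)) exc : Bool) := by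
      unfold KT.run leaf
      rw [hX]; rfl
    rw [e] at h
    clear e
    induction exc with
    | nil => simp at h
    | cons a l ih =>
      simp only at h
      by_cases ha : s.P = a
      · simp [ha]
      · have hb : Nat.beq s.P a = false := by
          rw [← Bool.not_eq_true, Nat.beq_eq]; exact ha
        rw [hb] at h
        exact List.mem_cons_of_mem _ (ih h)
  · exact Or.inl hX

theorem phaseB_sound {n N L : ℕ} {pl exc : List ℕ} {m k : ℕ} {s : St}
    (h : (phaseB n N L pl exc m k).run s = true) (hk : s.P % m = k) :
    (srch ((cellsB N).map (mkC n N L pl)) (leaf exc)).run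
      ⟨s.A + pack (5+5*N) (fun f => if 5 ≤ f ∧ (f - 5)/N = 3 then 1 else 0) *
         (G23 - 1 - (Nat.land (Nat.shiftRight s.A (24*(5+3*N))) 16777215)), s.P, s.Q, s.T, s.pr, s.X⟩
      = true := by
  unfold KT.run phaseB at h
  have : Nat.beq (Nat.mod s.P m) k = true := by
    rw [Nat.beq_eq]; exact hk
  rw [this] at h
  exact h

theorem runS_sound {n N L : ℕ} {pl exc : List ℕ} {m : ℕ} {M : ℕ → ℕ → ℕ} (hm : 0 < m)
    (h : Good n N M) (hrun : ∀ k, k < m → runS n N L pl exc m k = true) :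
    (∃ g : ℕ → Fin 5, ∀ i j, i < j → j < N → okd (M i j) (g j - g i).val = true) ∨
    (∃ P ∈ exc, ∀ b, P.testBit b = true ↔
      ∃ i j, i < j ∧ j < N ∧ M i j ≠ 0 ∧ b = 32 * j + 8 * (M i j - 1) + i) := by
  have hG : G23 = 8388608 := rfl
  have h3 := h.N3
  have h8 := h.N8
  set s0 : St := ⟨pack (5+5*N) (initF n N), 0, 0, 2^N-1, 0, 2^L-1⟩ with hs0
  have I0 : SInv N L pl M [] s0 := by
    constructor
    · intro b; simp [hs0]
    · intro b; simp [hs0]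
    · intro j _ i hi; simp at hi
    · intro c hc; simp at hc
    · intro b hb
      simp only [hs0, Nat.testBit_two_pow_sub_one, decide_eq_true_eq] at hb
      exact ⟨hb, by simp⟩
  have A0 : s0.A = pack (5+5*N) (fv N M (x0D n N 0) []) := by
    apply pack_congr
    intro f _
    simp [fv, x0D]
  have step1 : ∀ k < m, ∃ s', (phaseB n N L pl exc m k).run s' = true ∧ SInv N L pl M (cellsA N) s' ∧
      s'.A = pack (5+5*N) (fv N M (x0D n N 0) (cellsA N)) := by
    intro k hk
    have := phase_sound (k := phaseB n N L pl exc m k) h.toLocalRules (cellsA N) [] s0 I0 A0 (hrun k hk) (by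
      intro pre c post hs
      refine h.cellOK (post := post ++ cellsB N) (by rw [hG]; omega) (by simp [cellsAll, hs]) ?_
      intro hc
      have : c ∈ cellsA N := by rw [hs]; simp
      simp only [cellsA, List.mem_map] at this
      obtain ⟨j, _, rfl⟩ := this
      simp at hc)
    simpa using this
  obtain ⟨s1, _, I1, _⟩ := step1 0 hm
  obtain ⟨s2, r2, I2, A2⟩ := step1 (s1.P % m) (Nat.mod_lt _ hm)
  have eP : s2.P = s1.P := by
    apply Nat.eq_of_testBit_eq
    intro b
    rw [Bool.eq_iff_iff, I1.P, I2.P]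
  have r3 := phaseB_sound r2 (by rw [eP])
  have hA1 : ∀ c ∈ cellsA N, c.1 < c.2 := by
    intro c hc
    exact (mem_cellsAll (N := N).1 (by simp [cellsAll, hc])).1
  have hlen := cellsAll_length h3 h8
  have hR : Nat.land (Nat.shiftRight s2.A (24*(5+3*N))) 16777215 = rowS N M rCode 0 := by
    rw [A2, pack_get (f := 5 + 3 * N) _ (by omega)]
    · have e1 : (5 + 3 * N - 5) / N = 3 := by
        rw [show 5 + 3 * N - 5 = 3 * N by omega]
        exact Nat.mul_div_cancel _ (by omega)
      have e2 : (5 + 3 * N - 5) % N = 0 := by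
        rw [show 5 + 3 * N - 5 = 3 * N by omega]
        exact Nat.mul_mod_left _ _
      have t := tot_vertex h3 h8 h.sym h.diag rCode rfl (v := 0) (by omega)
      rw [cellsAll, List.map_append, List.sum_append] at t
      have z : ((cellsB N).map (fun c => if 0 = c.1 ∨ 0 = c.2 then rCode (M c.1 c.2) else 0)).sum = 0 := by
        apply List.sum_eq_zero
        intro x hx
        obtain ⟨d, hd, rfl⟩ := List.mem_map.1 hx
        simp only [cellsB, List.mem_flatMap, List.mem_map] at hd
        obtain ⟨a, _, b, _, rfl⟩ := hd
        simp
      rw [z] at t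
      simp only [fv, wt, x0D, initF, show ¬ (5 + 3 * N < 5) by omega, if_false, e1, e2]
      simp only [ite_self, zero_add]
      simpa using t
    · intro f hf
      apply h.fB (by rw [hG]; omega) _ _ hA1
      rw [cellsAll, List.length_append] at hlen
      omega
  rw [hR] at r3
  set D := G23 - 1 - rowS N M rCode 0 with hD
  have hRlt : rowS N M rCode 0 ≤ N * 135168 := by
    unfold rowS
    calc _ ≤ ∑ u ∈ Finset.range N, 135168 := by
          apply Finset.sum_le_sum
          intro u _
          have h4 := h.le4 0 u
          generalize M 0 u = r at *
          interval_cases r <;> decide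
      _ = _ := by simp
  have I3 : SInv N L pl M (cellsA N) ⟨s2.A + pack (5+5*N) (fun f => if 5 ≤ f ∧ (f - 5)/N = 3 then 1 else 0) * D,
      s2.P, s2.Q, s2.T, s2.pr, s2.X⟩ := ⟨I2.P, I2.Q, I2.T, I2.pr, I2.X⟩
  have := phase_sound (x0 := x0D n N D) h.toLocalRules (cellsB N) (cellsA N) _ I3 (by
      simp only
      rw [A2, pack_mul, pack_add]
      apply pack_congr
      intro f _
      simp only [fv, x0D]
      split_ifs <;> omega) r3 (by
      intro pre c post hs
      refine h.cellOK (post := post) (by omega) (by simp [cellsAll, hs]) ?_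
      intro _
      omega)
  obtain ⟨s4, r4, I4, _⟩ := this
  rcases leaf_sound r4 with hX | hP
  · left
    obtain ⟨b, hb⟩ := Nat.exists_testBit_of_ne_zero hX
    obtain ⟨_, hc⟩ := I4.X b hb
    refine ⟨tcol pl b, ?_⟩
    intro i j hij hj
    exact hc (i, j) (mem_cellsAll.2 ⟨hij, hj⟩)
  · right
    refine ⟨s4.P, hP, ?_⟩
    intro b
    rw [I4.P]
    constructor
    · rintro ⟨⟨i, j⟩, hc, h1, h2⟩
      have := mem_cellsAll.1 hc
      exact ⟨i, j, this.1, this.2, h1, h2⟩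
    · rintro ⟨i, j, h1, h2, h3, h4⟩
      exact ⟨(i, j), mem_cellsAll.2 ⟨h1, h2⟩, h3, h4⟩

/-! ## Part 2: critical graphs and their strings -/

/-- adjacency in the 5-cycle of colours -/
def Cc (x y : Fin 5) : Prop := y - x = 1 ∨ y - x = 4

instance : DecidableRel Cc := fun x y => by unfold Cc; infer_instance

theorem Cc.symm {x y : Fin 5} (h : Cc x y) : Cc y x := by
  revert x y; decide

theorem Cc_iff (x y : Fin 5) : (cycleGraph 5).Adj x y ↔ Cc x y := by
  rw [cycleGraph_adj]
  revert x y; unfold Cc; decide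

structure Cr {V : Type} (G : SimpleGraph V) : Prop where
  nocol : ∀ f : V → Fin 5, ¬ ∀ u v, G.Adj u v → Cc (f u) (f v)
  edge : ∀ a b, G.Adj a b → ∃ f : V → Fin 5, ∀ u v, G.Adj u v → s(u,v) ≠ s(a,b) → Cc (f u) (f v)
  noiso : ∀ a, ∃ b, G.Adj a b

theorem Critical52.cr {V : Type} {G : SimpleGraph V} (h : Critical52 G) : Cr G := by
  classical
  have nocol : ∀ f : V → Fin 5, ¬ ∀ u v, G.Adj u v → Cc (f u) (f v) := by
    intro f hf
    exact h.1.elim ⟨f, fun {u v} hu => (Cc_iff _ _).2 (hf u v hu)⟩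
  refine ⟨nocol, ?_, ?_⟩
  · intro a b hab
    obtain ⟨φ⟩ := h.2 ((⊤ : G.Subgraph).deleteEdges {s(a,b)}) (by
      intro e
      have : ((⊤ : G.Subgraph).deleteEdges {s(a,b)}).Adj a b := by rw [e]; exact hab
      simp at this)
    refine ⟨fun v => φ ⟨v, by simp⟩, ?_⟩
    intro u v huv hne
    rw [← Cc_iff]
    apply φ.map_rel
    rw [Subgraph.coe_adj, Subgraph.deleteEdges_adj]
    exact ⟨huv, by simpa using hne⟩
  · intro a
    by_contra hno
    push Not at hno
    obtain ⟨φ⟩ := h.2 ((⊤ : G.Subgraph).deleteVerts {a}) (by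
      intro e
      have : a ∈ ((⊤ : G.Subgraph).deleteVerts {a}).verts := by rw [e]; simp
      simp at this)
    refine nocol (fun v => if hv : v = a then 0 else φ ⟨v, by simpa using hv⟩) ?_
    intro u v huv
    have hu : u ≠ a := by rintro rfl; exact hno _ huv
    have hv : v ≠ a := by rintro rfl; exact hno _ huv.symm
    simp only [dif_neg hu, dif_neg hv]
    rw [← Cc_iff]
    apply φ.map_rel
    simp [huv, hu, hv]

namespace Cr
variable {V : Type} [Fintype V] {G : SimpleGraph V}

open Classical in
/-- neighbours -/
noncomputable def nb (G : SimpleGraph V) (v : V) : Finset V := Finset.univ.filter (G.Adj v)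

theorem mem_nb {v w : V} : w ∈ nb G v ↔ G.Adj v w := by simp [nb]

theorem no_tri (h : Cr G) (hn : 3 < Fintype.card V) {a b c : V} (hab : G.Adj a b) (hbc : G.Adj b c)
    (hac : G.Adj a c) : False := by
  classical
  have h1 : ∃ v, v ∉ ({a, b, c} : Finset V) := by
    by_contra hh
    push Not at hh
    have : (Finset.univ : Finset V) ⊆ {a, b, c} := fun v _ => hh v
    have := Finset.card_le_card this
    have h3 := Finset.card_le_three (a := a) (b := b) (c := c)
    rw [Finset.card_univ] at this
    omega
  obtain ⟨v, hv⟩ := h1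
  simp only [Finset.mem_insert, Finset.mem_singleton, not_or] at hv
  obtain ⟨w, hw⟩ := h.noiso v
  obtain ⟨f, hf⟩ := h.edge v w hw
  have e : ∀ x y, x ≠ v → y ≠ v → s(x,y) ≠ s(v,w) := by
    intro x y hx hy he
    rw [Sym2.eq_iff] at he
    tauto
  have k1 := hf _ _ hab (e _ _ (Ne.symm hv.1) (Ne.symm hv.2.1))
  have k2 := hf _ _ hbc (e _ _ (Ne.symm hv.2.1) (Ne.symm hv.2.2))
  have k3 := hf _ _ hac (e _ _ (Ne.symm hv.1) (Ne.symm hv.2.2))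
  revert k1 k2 k3
  generalize f a = x
  generalize f b = y
  generalize f c = z
  revert x y z
  decide

theorem two_nb (h : Cr G) (v x : V) : ∃ y, G.Adj v y ∧ y ≠ x := by
  classical
  by_contra hno
  push Not at hno
  obtain ⟨w, hw⟩ := h.noiso v
  obtain rfl := hno w hw
  obtain ⟨f, hf⟩ := h.edge v w hw
  apply h.nocol (fun z => if z = v then f w + 1 else f z)
  intro a b hab
  by_cases ha : a = v
  · subst ha
    obtain rfl := hno b hab
    have hne : b ≠ a := hab.ne'
    simp [hne, Cc]
    decide
  · by_cases hb : b = v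
    · subst hb
      obtain rfl := hno a hab.symm
      simp [ha, Cc]
    · simp only [ha, hb, if_false]
      apply hf a b hab
      intro he
      rw [Sym2.eq_iff] at he
      tauto

/-- branch vertices -/
def Br (G : SimpleGraph V) (v : V) : Prop := 3 ≤ (nb G v).card

/-- the second neighbour -/
noncomputable def oth (h : Cr G) (a x : V) : V := (h.two_nb a x).choose

theorem oth_adj (h : Cr G) (a x : V) : G.Adj a (h.oth a x) := (h.two_nb a x).choose_spec.1
theorem oth_ne (h : Cr G) (a x : V) : h.oth a x ≠ x := (h.two_nb a x).choose_spec.2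

theorem oth_or (h : Cr G) {a x y : V} (ha : ¬ Br G a) (hx : G.Adj a x) (hy : G.Adj a y) :
    y = x ∨ y = h.oth a x := by
  classical
  by_contra hno
  push Not at hno
  apply ha
  unfold Br
  have : ({y, x, h.oth a x} : Finset V) ⊆ nb G a := by
    intro z hz
    simp only [Finset.mem_insert, Finset.mem_singleton] at hz
    rw [mem_nb]
    rcases hz with rfl | rfl | rfl
    · exact hy
    · exact hx
    · exact h.oth_adj _ _
  refine le_trans (le_of_eq ?_) (Finset.card_le_card this)
  rw [Finset.card_eq_three.2 ⟨y, x, _, hno.1, hno.2, (h.oth_ne a x).symm, rfl⟩]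

theorem nb_of_not_br (h : Cr G) {a : V} (ha : ¬ Br G a) : ∃ x y, x ≠ y ∧ G.Adj a x ∧ G.Adj a y ∧
    ∀ z, G.Adj a z → z = x ∨ z = y := by
  obtain ⟨x, hx⟩ := h.noiso a
  exact ⟨x, h.oth a x, (h.oth_ne a x).symm, hx, h.oth_adj a x, fun z hz => h.oth_or ha hx hz⟩

theorem card_nb_of_not_br (h : Cr G) {a : V} (ha : ¬ Br G a) : (nb G a).card = 2 := by
  classical
  obtain ⟨x, y, hxy, hx, hy, hz⟩ := h.nb_of_not_br ha
  rw [Finset.card_eq_two]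
  refine ⟨x, y, hxy, ?_⟩
  ext z
  rw [mem_nb, Finset.mem_insert, Finset.mem_singleton]
  constructor
  · exact hz z
  · rintro (rfl | rfl) <;> assumption

theorem no_three (h : Cr G) (hn : 3 < Fintype.card V) {a b c : V} (ha : ¬ Br G a) (hb : ¬ Br G b)
    (hc : ¬ Br G c) (hab : G.Adj a b) (hbc : G.Adj b c) (hac : a ≠ c) : False := by
  classical
  obtain ⟨f, hf⟩ := h.edge a b hab
  have hx := h.oth_adj a b
  have hxo : ∀ z, G.Adj a z → z = b ∨ z = h.oth a b := fun z hz => h.oth_or ha hab hz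
  have hxb := h.oth_ne a b
  have hyo : ∀ z, G.Adj c z → z = b ∨ z = h.oth c b := fun z hz => h.oth_or hc hbc.symm hz
  have hyb := h.oth_ne c b
  have hy := h.oth_adj c b
  have hbo : ∀ z, G.Adj b z → z = a ∨ z = c := by
    intro z hz
    rcases h.oth_or hb hab.symm hz with h1 | h1
    · exact Or.inl h1
    · rcases h.oth_or hb hab.symm hbc with h2 | h2
      · exact absurd h2.symm hac
      · right; rw [h1, h2]
  generalize h.oth a b = x at *
  generalize h.oth c b = y at *
  have hxc : x ≠ c := by rintro rfl; exact h.no_tri hn hab hbc hx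
  have hya : y ≠ a := by rintro rfl; exact h.no_tri hn hab hbc hy.symm
  have hac' : ¬ G.Adj a c := fun hh => h.no_tri hn hab hbc hh
  have key : ∀ p q : Fin 5, ∃ r s t : Fin 5, Cc p r ∧ Cc r s ∧ Cc s t ∧ Cc t q := by decide
  obtain ⟨r, s, t, h1, h2, h3, h4⟩ := key (f x) (f y)
  have nab := hab.ne
  have nbc := hbc.ne
  have nax := hx.ne
  have ncy := hy.ne
  apply h.nocol (fun z => if z = a then r else if z = b then s else if z = c then t else f z)
  have main : ∀ u v, G.Adj u v → (u = a ∨ u = b ∨ u = c) →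
      Cc (if u = a then r else if u = b then s else if u = c then t else f u)
      (if v = a then r else if v = b then s else if v = c then t else f v) := by
    intro u v huv hu
    rcases hu with rfl | rfl | rfl
    · rcases hxo v huv with rfl | rfl
      · simp [nab.symm, h2]
      · simp [nax.symm, hxb, hxc, h1.symm]
    · rcases hbo v huv with rfl | rfl
      · simp [nab.symm, h2.symm]
      · simp [nab.symm, nbc.symm, hac.symm, h3]
    · rcases hyo v huv with rfl | rfl
      · simp [nab.symm, nbc.symm, hac.symm, h3.symm]
      · simp [nbc.symm, hac.symm, hya, hyb, ncy.symm, h4]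
  intro u v huv
  by_cases hu : u = a ∨ u = b ∨ u = c
  · exact main u v huv hu
  · by_cases hv : v = a ∨ v = b ∨ v = c
    · exact (main v u huv.symm hv).symm
    · push Not at hu hv
      simp only [hu.1, hu.2.1, hu.2.2, hv.1, hv.2.1, hv.2.2, if_false]
      apply hf u v huv
      intro he
      rw [Sym2.eq_iff] at he
      tauto

end Cr

namespace Cr
variable {V : Type} [Fintype V] {G : SimpleGraph V}

/-- the string leaving `u` through its neighbour `w` has `t` inner vertices and ends in `v` -/
def Tr (G : SimpleGraph V) (u w : V) (t : ℕ) (v : V) : Prop :=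
  (t = 0 ∧ Br G w ∧ w = v) ∨ (t = 1 ∧ ¬ Br G w ∧ Br G v ∧ G.Adj w v ∧ v ≠ u) ∨
  (t = 2 ∧ ¬ Br G w ∧ Br G v ∧ ∃ b, ¬ Br G b ∧ G.Adj w b ∧ G.Adj b v)

/-- there is a string with `t` inner vertices from `u` to `v` -/
def Sg (G : SimpleGraph V) (t : ℕ) (u v : V) : Prop := Br G u ∧ ∃ w, G.Adj u w ∧ Tr G u w t v

theorem ne_of_br {a b : V} (ha : Br G a) (hb : ¬ Br G b) : a ≠ b := by rintro rfl; exact hb ha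

theorem two_uniq (h : Cr G) {a x y z : V} (ha : ¬ Br G a) (hx : G.Adj a x) (hy : G.Adj a y)
    (hz : G.Adj a z) (hyx : y ≠ x) (hzx : z ≠ x) : y = z := by
  rcases h.oth_or ha hx hy with h1 | h1
  · exact absurd h1 hyx
  · rcases h.oth_or ha hx hz with h2 | h2
    · exact absurd h2 hzx
    · rw [h1, h2]

theorem tr_exists (h : Cr G) (hn : 3 < Fintype.card V) (u w : V) :
    ∃ t v, Tr G u w t v := by
  by_cases hb : Br G w
  · exact ⟨0, w, Or.inl ⟨rfl, hb, rfl⟩⟩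
  · by_cases hb2 : Br G (h.oth w u)
    · exact ⟨1, _, Or.inr (Or.inl ⟨rfl, hb, hb2, h.oth_adj _ _, h.oth_ne _ _⟩)⟩
    · refine ⟨2, h.oth (h.oth w u) w, Or.inr (Or.inr ⟨rfl, hb, ?_, h.oth w u, hb2,
        h.oth_adj _ _, h.oth_adj _ _⟩)⟩
      by_contra hb3
      exact h.no_three hn hb hb2 hb3 (h.oth_adj _ _) (h.oth_adj _ _) (h.oth_ne _ _).symm

theorem tr_unique (h : Cr G) {u w v v' : V} {t t' : ℕ} (hu : Br G u) (hw : G.Adj u w)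
    (h1 : Tr G u w t v) (h2 : Tr G u w t' v') : t = t' ∧ v = v' := by
  rcases h1 with ⟨rfl, a1, rfl⟩ | ⟨rfl, a1, a2, a3, a4⟩ | ⟨rfl, a1, a2, b, a3, a4, a5⟩ <;>
  rcases h2 with ⟨rfl, c1, rfl⟩ | ⟨rfl, c1, c2, c3, c4⟩ | ⟨rfl, c1, c2, d, c3, c4, c5⟩ <;>
  first | exact absurd ‹Br G w› ‹¬ Br G w› | skip
  · exact ⟨rfl, rfl⟩
  · exact ⟨rfl, h.two_uniq a1 hw.symm a3 c3 a4 c4⟩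
  · have := h.two_uniq a1 hw.symm a3 c4 a4 (ne_of_br hu c3).symm
    rw [this] at a2
    exact absurd a2 c3
  · have := h.two_uniq a1 hw.symm a4 c3 (ne_of_br hu a3).symm c4
    rw [← this] at c2
    exact absurd c2 a3
  · have := h.two_uniq a1 hw.symm a4 c4 (ne_of_br hu a3).symm (ne_of_br hu c3).symm
    subst this
    exact ⟨rfl, h.two_uniq a3 a4.symm a5 c5 (ne_of_br a2 a1) (ne_of_br c2 c1)⟩

theorem sg_br {t : ℕ} {u v : V} (h : Sg G t u v) : Br G u ∧ Br G v := by
  obtain ⟨hu, w, hw, ⟨_, a1, rfl⟩ | ⟨_, a1, a2, a3, a4⟩ | ⟨_, a1, a2, b, a3, a4, a5⟩⟩ := h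
  · exact ⟨hu, a1⟩
  · exact ⟨hu, a2⟩
  · exact ⟨hu, a2⟩

theorem sg_ne (h : Cr G) (hn : 3 < Fintype.card V) {t : ℕ} {u v : V} (hs : Sg G t u v) : u ≠ v := by
  obtain ⟨hu, w, hw, ⟨_, a1, rfl⟩ | ⟨_, a1, a2, a3, a4⟩ | ⟨_, a1, a2, b, a3, a4, a5⟩⟩ := hs
  · exact hw.ne
  · exact a4.symm
  · rintro rfl
    exact h.no_tri hn hw a4 a5.symm

theorem sg_symm {t : ℕ} {u v : V} (hs : Sg G t u v) : Sg G t v u := by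
  obtain ⟨hu, w, hw, ⟨rfl, a1, rfl⟩ | ⟨rfl, a1, a2, a3, a4⟩ | ⟨rfl, a1, a2, b, a3, a4, a5⟩⟩ := hs
  · exact ⟨a1, u, hw.symm, Or.inl ⟨rfl, hu, rfl⟩⟩
  · exact ⟨a2, w, a3.symm, Or.inr (Or.inl ⟨rfl, a1, hu, hw.symm, a4.symm⟩)⟩
  · exact ⟨a2, b, a5.symm, Or.inr (Or.inr ⟨rfl, a3, hu, w, a1, a4.symm, hw.symm⟩)⟩

theorem tr_inj (h : Cr G) (hn : 3 < Fintype.card V) {u w w' v : V} {t : ℕ} (hu : Br G u) (hw : G.Adj u w)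
    (hw' : G.Adj u w') (h1 : Tr G u w t v) (h2 : Tr G u w' t v) : w = w' := by
  classical
  by_contra hne
  obtain ⟨f, hf⟩ := h.edge u w hw
  have hf' : ∀ x y, G.Adj x y → x ≠ w → y ≠ w → Cc (f x) (f y) := by
    intro x y hxy hx hy
    apply hf x y hxy
    intro he
    rw [Sym2.eq_iff] at he
    tauto
  rcases h1 with ⟨rfl, a1, rfl⟩ | ⟨rfl, a1, a2, a3, a4⟩ | ⟨rfl, a1, a2, b, a3, a4, a5⟩ <;>
  rcases h2 with ⟨e, c1, c0⟩ | ⟨e, c1, c2, c3, c4⟩ | ⟨e, c1, c2, d, c3, c4, c5⟩ <;>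
  first | (exfalso; clear * - e; omega) | skip
  · exact hne c0.symm
  · apply h.nocol (fun z => if z = w then f w' else f z)
    have main : ∀ y, G.Adj w y → Cc (f w') (if y = w then f w' else f y) := by
      intro y hy
      rw [if_neg hy.ne']
      by_cases hyu : y = u
      · subst hyu
        exact hf' _ _ hw'.symm (Ne.symm hne) hw.ne
      · obtain rfl := h.two_uniq a1 hw.symm hy a3 hyu a4
        exact hf' _ _ c3 (Ne.symm hne) hy.ne'
    intro x y hxy
    by_cases hx : x = w
    · subst hx; simpa using main y hxy
    · by_cases hy : y = w
      · subst hy; simpa using (main x hxy.symm).symm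
      · simp only [hx, hy, if_false]; exact hf' x y hxy hx hy
  · have hbd : b ≠ d := by
      rintro rfl
      exact (ne_of_br a2 c1) (h.two_uniq a3 a4.symm a5 c4.symm (ne_of_br a2 a1) (Ne.symm hne))
    have huv : u ≠ v := h.sg_ne hn ⟨hu, w, hw, Or.inr (Or.inr ⟨rfl, a1, a2, b, a3, a4, a5⟩)⟩
    have hdw : d ≠ w := by
      rintro rfl
      exact (ne_of_br c2 a3) (h.two_uniq a1 hw.symm c5 a4 huv.symm (ne_of_br hu a3).symm)
    have hbw' : w' ≠ b := by
      rintro rfl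
      exact huv (h.two_uniq a3 a4.symm hw'.symm a5 (ne_of_br hu a1) (ne_of_br a2 a1))
    apply h.nocol (fun z => if z = w then f w' else if z = b then f d else f z)
    have e1 : Cc (f w') (f u) := hf' _ _ hw'.symm (Ne.symm hne) hw.ne
    have e2 : Cc (f w') (f d) := hf' _ _ c4 (Ne.symm hne) hdw
    have e3 : Cc (f d) (f v) := hf' _ _ c5 hdw (ne_of_br a2 a1)
    have main : ∀ x y, G.Adj x y → (x = w ∨ x = b) →
        Cc (if x = w then f w' else if x = b then f d else f x)
        (if y = w then f w' else if y = b then f d else f y) := by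
      intro x y hxy hx
      rcases hx with rfl | rfl
      · by_cases hyu : y = u
        · subst hyu
          simp [hxy.ne', ne_of_br hu a3, e1]
        · obtain rfl := h.two_uniq a1 hw.symm hxy a4 hyu (ne_of_br hu a3).symm
          simp [hxy.ne', e2]
      · by_cases hyw : y = w
        · subst hyw
          simp [hxy.ne, e2.symm]
        · obtain rfl := h.two_uniq a3 a4.symm hxy a5 hyw (ne_of_br a2 a1)
          simp [hxy.ne', hyw, a4.ne', e3]
    intro x y hxy
    by_cases hx : x = w ∨ x = b
    · exact main x y hxy hx
    · by_cases hy : y = w ∨ y = b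
      · exact (main y x hxy.symm hy).symm
      · push Not at hx hy
        simp only [hx.1, hx.2, hy.1, hy.2, if_false]
        exact hf' x y hxy hx.1 hy.1

/-- allowed differences for a string with `t` inner vertices -/
def okt (t : ℕ) (d : Fin 5) : Prop := okd ([2,1,3].getD t 0) d.val = true

theorem sg_cr (h : Cr G) {t : ℕ} {u v : V} (hs : Sg G t u v) :
    ∃ g : V → Fin 5, ∀ t' x y, Sg G t' x y → ¬ (t' = t ∧ s(x,y) = s(u,v)) → okt t' (g y - g x) := by
  obtain ⟨hu, w, hw, hT⟩ := hs
  obtain ⟨f, hf⟩ := h.edge u w hw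
  refine ⟨f, ?_⟩
  intro t' x y hs' hne
  have k0 : ∀ p, Br G p → ¬ Br G w → G.Adj p w → Tr G p w t' x → p = u → p = y → False := by
    intro p _ _ _ hp e1 e2
    subst e1
    obtain ⟨r1, r2⟩ := h.tr_unique hu hw hT hp
    exact hne ⟨r1.symm, by rw [← e2, ← r2]; exact Sym2.eq_swap⟩
  have k1 : ∀ p, Br G p → ¬ Br G w → G.Adj p w → Tr G p w t' y → p = u → p = x → False := by
    intro p _ _ _ hp e1 e2
    subst e1
    obtain ⟨r1, r2⟩ := h.tr_unique hu hw hT hp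
    exact hne ⟨r1.symm, by rw [← e2, ← r2]⟩
  obtain ⟨hx, w', hw', ⟨rfl, a1, rfl⟩ | ⟨rfl, a1, a2, a3, a4⟩ | ⟨rfl, a1, a2, b, a3, a4, a5⟩⟩ := hs'
  · have := hf x w' hw' (by
      intro he
      have hwB : Br G w := by
        rw [Sym2.eq_iff] at he
        rcases he with ⟨_, rfl⟩ | ⟨rfl, _⟩ <;> assumption
      obtain ⟨r1, r2⟩ := h.tr_unique hu hw hT (Or.inl ⟨rfl, hwB, rfl⟩)
      exact hne ⟨r1.symm, by rw [he, r2]⟩)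
    revert this
    generalize f x = p
    generalize f w' = q
    unfold okt
    revert p q; decide
  · have t1 := hf x w' hw' (by
      intro he
      rw [Sym2.eq_iff] at he
      rcases he with ⟨rfl, rfl⟩ | ⟨_, rfl⟩
      · exact k1 x hx a1 hw' (Or.inr (Or.inl ⟨rfl, a1, a2, a3, a4⟩)) rfl rfl
      · exact a1 hu)
    have t2 := hf w' y a3 (by
      intro he
      rw [Sym2.eq_iff] at he
      rcases he with ⟨rfl, _⟩ | ⟨rfl, rfl⟩
      · exact a1 hu
      · exact k0 y a2 a1 a3.symm (Or.inr (Or.inl ⟨rfl, a1, hx, hw'.symm, a4.symm⟩)) rfl rfl)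
    revert t1 t2
    generalize f x = p
    generalize f w' = q
    generalize f y = r
    unfold okt
    revert p q r; decide
  · have t1 := hf x w' hw' (by
      intro he
      rw [Sym2.eq_iff] at he
      rcases he with ⟨rfl, rfl⟩ | ⟨_, rfl⟩
      · exact k1 x hx a1 hw' (Or.inr (Or.inr ⟨rfl, a1, a2, b, a3, a4, a5⟩)) rfl rfl
      · exact a1 hu)
    have t2 := hf w' b a4 (by
      intro he
      rw [Sym2.eq_iff] at he
      rcases he with ⟨rfl, _⟩ | ⟨_, rfl⟩
      · exact a1 hu
      · exact a3 hu)
    have t3 := hf b y a5 (by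
      intro he
      rw [Sym2.eq_iff] at he
      rcases he with ⟨rfl, _⟩ | ⟨rfl, rfl⟩
      · exact a3 hu
      · exact k0 y a2 a3 a5.symm (Or.inr (Or.inr ⟨rfl, a3, hx, w', a1, a4.symm, hw'.symm⟩)) rfl rfl)
    revert t1 t2 t3
    generalize f x = p
    generalize f w' = q
    generalize f b = r
    generalize f y = s
    unfold okt
    revert p q r s; decide

/-- colour of the inner vertex next to an end coloured `x` of a path of length 3 -/
def gg (x y : Fin 5) : Fin 5 :=
  if y - x = 1 ∨ y - x = 4 then y else if y - x = 2 then x - 1 else x + 1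

theorem sg_nc (h : Cr G) (hn : 3 < Fintype.card V) (g : V → Fin 5) :
    ¬ ∀ t u v, Sg G t u v → okt t (g v - g u) := by
  intro hg
  have key : ∀ v, ∃ c, (Br G v → c = g v) ∧ (¬ Br G v →
      (∀ x w z, G.Adj v x → Br G x → ¬ Br G w → G.Adj v w → G.Adj w z → Br G z →
        c = gg (g x) (g z)) ∧ ((∀ x, G.Adj v x → Br G x) → ∀ x, G.Adj v x → Cc (g x) c)) := by
    intro v
    by_cases hv : Br G v
    · exact ⟨g v, fun _ => rfl, fun hh => absurd hv hh⟩
    · by_cases hall : ∀ x, G.Adj v x → Br G x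
      · obtain ⟨x, y, hxy, hx, hy, hz⟩ := h.nb_of_not_br hv
        have h1 := hg 1 x y ⟨hall x hx, v, hx.symm, Or.inr (Or.inl ⟨rfl, hv, hall y hy, hy, hxy.symm⟩)⟩
        have h2 : ∃ c, Cc (g x) c ∧ Cc (g y) c := by
          revert h1
          generalize g x = p
          generalize g y = q
          unfold okt
          revert p q; decide
        obtain ⟨c, hc1, hc2⟩ := h2
        refine ⟨c, fun hh => absurd hh hv, fun _ => ⟨?_, fun _ z hz' => ?_⟩⟩
        · intro x w z _ _ hw1 hw2
          exact absurd (hall w hw2) hw1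
        · rcases hz z hz' with rfl | rfl <;> assumption
      · push Not at hall
        obtain ⟨w, hw, hwB⟩ := hall
        refine ⟨gg (g (h.oth v w)) (g (h.oth w v)), fun hh => absurd hh hv, fun _ => ⟨?_, ?_⟩⟩
        · intro x w' z hx hxB hw'B hw' hz hzB
          obtain rfl := h.two_uniq hv hx hw hw' (ne_of_br hxB hwB).symm (ne_of_br hxB hw'B).symm
          rw [← h.two_uniq hv hw hx (h.oth_adj v w) (ne_of_br hxB hwB) (h.oth_ne v w)]
          rw [← h.two_uniq hwB hw.symm hz (h.oth_adj w v) (ne_of_br hzB hv) (h.oth_ne w v)]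
        · intro hh
          exact absurd (hh w hw) hwB
  choose f hf1 hf2 using key
  have g1 : ∀ p q : Fin 5, okt 2 (q - p) → Cc p (gg p q) ∧ Cc (gg p q) (gg q p) := by
    unfold okt; decide
  have oB : ∀ v w, ¬ Br G v → ¬ Br G w → G.Adj v w → Br G (h.oth w v) := by
    intro v w hv hw hvw
    by_contra hb
    exact h.no_three hn hv hw hb hvw (h.oth_adj _ _) (h.oth_ne _ _).symm
  have case2 : ∀ u v, G.Adj u v → Br G u → ¬ Br G v → Cc (f u) (f v) := by
    intro u v huv hu hv
    rw [hf1 u hu]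
    by_cases hall : ∀ x, G.Adj v x → Br G x
    · exact (hf2 v hv).2 hall u huv.symm
    · push Not at hall
      obtain ⟨w, hw, hwB⟩ := hall
      have hz := oB v w hv hwB hw
      rw [(hf2 v hv).1 u w _ huv.symm hu hwB hw (h.oth_adj w v) hz]
      exact (g1 _ _ (hg 2 u _ ⟨hu, v, huv, Or.inr (Or.inr
        ⟨rfl, hv, hz, w, hwB, hw, h.oth_adj w v⟩)⟩)).1
  apply h.nocol f
  intro u v huv
  by_cases hu : Br G u
  · by_cases hv : Br G v
    · rw [hf1 u hu, hf1 v hv]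
      have := hg 0 u v ⟨hu, v, huv, Or.inl ⟨rfl, hv, rfl⟩⟩
      revert this
      generalize g u = p
      generalize g v = q
      unfold okt
      revert p q; decide
    · exact case2 u v huv hu hv
  · by_cases hv : Br G v
    · exact (case2 v u huv.symm hv hu).symm
    · have hx := oB v u hv hu huv.symm
      have hz := oB u v hu hv huv
      rw [(hf2 u hu).1 _ v _ (h.oth_adj u v) hx hv huv (h.oth_adj v u) hz]
      rw [(hf2 v hv).1 _ u _ (h.oth_adj v u) hz hu huv.symm (h.oth_adj u v) hx]
      exact (g1 _ _ (hg 2 _ _ ⟨hx, u, (h.oth_adj u v).symm, Or.inr (Or.inr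
        ⟨rfl, hu, hz, v, hv, huv, h.oth_adj v u⟩)⟩)).2
end Cr

namespace Cr
variable {V : Type} [Fintype V] {G : SimpleGraph V}

theorem sg_le {t : ℕ} {u v : V} (h : Sg G t u v) : t ≤ 2 := by
  obtain ⟨hu, w, hw, ⟨rfl, _⟩ | ⟨rfl, _⟩ | ⟨rfl, _⟩⟩ := h <;> omega

theorem sg_ex01 (h : Cr G) (hn : 3 < Fintype.card V) {u v : V} (h0 : Sg G 0 u v) (h1 : Sg G 1 u v) :
    False := by
  obtain ⟨hu, w, hw, ⟨_, a1, rfl⟩ | ⟨e, _⟩ | ⟨e, _⟩⟩ := h0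
  · obtain ⟨_, w', hw', ⟨e, _⟩ | ⟨_, b1, b2, b3, b4⟩ | ⟨e, _⟩⟩ := h1
    · omega
    · exact h.no_tri hn hw' b3 hw
    · omega
  · omega
  · omega

theorem sg_ex02 (h : Cr G) (hn : 3 < Fintype.card V) {u v : V} (h0 : Sg G 0 u v) (h2 : Sg G 2 u v) :
    False := by
  obtain ⟨g, hg⟩ := h.sg_cr h2
  apply h.sg_nc hn g
  intro t x y hs
  by_cases hh : t = 2 ∧ s(x,y) = s(u,v)
  · obtain ⟨rfl, he⟩ := hh
    have : Sg G 0 x y := by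
      rw [Sym2.eq_iff] at he
      rcases he with ⟨rfl, rfl⟩ | ⟨rfl, rfl⟩
      · exact h0
      · exact sg_symm h0
    have := hg 0 x y this (by omega)
    revert this
    generalize g x = p
    generalize g y = q
    unfold okt
    revert p q; decide
  · exact hg t x y hs hh

open Classical in
/-- the rank of a pair of branch vertices -/
noncomputable def rank (G : SimpleGraph V) (u v : V) : ℕ :=
  if Sg G 0 u v then 2 else if Sg G 1 u v then (if Sg G 2 u v then 4 else 1)
  else if Sg G 2 u v then 3 else 0

theorem sg_comm {t : ℕ} {u v : V} : Sg G t u v ↔ Sg G t v u := ⟨sg_symm, sg_symm⟩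

theorem rank_symm (u v : V) : rank G u v = rank G v u := by
  unfold rank
  have e : ∀ t, Sg G t u v = Sg G t v u := fun t => propext sg_comm
  rw [e 0, e 1, e 2]

theorem rank_self (h : Cr G) (hn : 3 < Fintype.card V) (u : V) : rank G u u = 0 := by
  unfold rank
  have : ∀ t, ¬ Sg G t u u := fun t ht => h.sg_ne hn ht rfl
  simp [this]

theorem rank_le (u v : V) : rank G u v ≤ 4 := by
  unfold rank
  split_ifs <;> omega

theorem rank_br {u v : V} (h : rank G u v ≠ 0) : Br G u ∧ Br G v := by
  unfold rank at h
  split_ifs at h with h0 h1 h2 h3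
  · exact sg_br h0
  · exact sg_br h1
  · exact sg_br h1
  · exact sg_br h3
  · exact absurd rfl h

theorem rank_sum (h : Cr G) (hn : 3 < Fintype.card V) (u v : V) (φ ψ : ℕ → ℕ)
    (h0 : ψ 0 = 0) (h1 : ψ 1 = φ 1) (h2 : ψ 2 = φ 0) (h3 : ψ 3 = φ 2) (h4 : ψ 4 = φ 1 + φ 2)
    [∀ t, Decidable (Sg G t u v)] :
    ψ (rank G u v) = ∑ t ∈ Finset.range 3, if Sg G t u v then φ t else 0 := by
  have e1 := h.sg_ex01 hn (u := u) (v := v)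
  have e2 := h.sg_ex02 hn (u := u) (v := v)
  simp only [Finset.sum_range_succ, Finset.sum_range_zero]
  unfold rank
  by_cases a0 : Sg G 0 u v <;> by_cases a1 : Sg G 1 u v <;> by_cases a2 : Sg G 2 u v <;>
    simp_all

theorem rank_ok (u v : V) (d : Fin 5) (hr : okd (rank G u v) d.val = true)
    {t : ℕ} (hs : Sg G t u v) (h01 : Sg G 0 u v → ¬ Sg G 1 u v) (h02 : Sg G 0 u v → ¬ Sg G 2 u v) :
    okt t d := by
  have ht := sg_le hs
  unfold rank at hr
  interval_cases t
  · simp only [hs, if_true] at hr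
    revert hr; unfold okt; revert d; decide
  · have a0 : ¬ Sg G 0 u v := fun hh => h01 hh hs
    by_cases a2 : Sg G 2 u v
    · simp only [hs, a0, a2, if_true, if_false] at hr
      revert hr; unfold okt; revert d; decide
    · simp only [hs, a0, a2, if_true, if_false] at hr
      revert hr; unfold okt; revert d; decide
  · have a0 : ¬ Sg G 0 u v := fun hh => h02 hh hs
    by_cases a2 : Sg G 1 u v
    · simp only [hs, a0, a2, if_true, if_false] at hr
      revert hr; unfold okt; revert d; decide
    · simp only [hs, a0, a2, if_true, if_false] at hr
      revert hr; unfold okt; revert d; decide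

theorem ok_rank (u v : V) (d : Fin 5) (hs : ∀ t, Sg G t u v → okt t d) :
    okd (rank G u v) d.val = true := by
  have s0 := hs 0
  have s1 := hs 1
  have s2 := hs 2
  unfold rank
  by_cases a0 : Sg G 0 u v <;> by_cases a1 : Sg G 1 u v <;> by_cases a2 : Sg G 2 u v <;>
    simp only [a0, a1, a2, if_true, if_false, forall_true_left] at s0 s1 s2 ⊢ <;>
    clear a0 a1 a2 hs <;> revert s0 s1 s2 <;> unfold okt <;> revert d <;> decide

/-- number of inner vertices of a string, from the neighbour -/
noncomputable def ty (G : SimpleGraph V) (w : V) : ℕ :=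
  open Classical in if Br G w then 0 else if ∀ x, G.Adj w x → Br G x then 1 else 2

theorem tr_ty (h : Cr G) {u w v : V} {t : ℕ} (hu : Br G u) (hw : G.Adj u w) (hT : Tr G u w t v) :
    t = ty G w := by
  unfold ty
  rcases hT with ⟨rfl, a1, rfl⟩ | ⟨rfl, a1, a2, a3, a4⟩ | ⟨rfl, a1, a2, b, a3, a4, a5⟩
  · simp [a1]
  · have : ∀ x, G.Adj w x → Br G x := by
      intro x hx
      by_cases hxu : x = u
      · rw [hxu]; exact hu
      · rw [h.two_uniq a1 hw.symm hx a3 hxu a4]; exact a2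
    rw [if_neg a1, if_pos this]
  · have : ¬ ∀ x, G.Adj w x → Br G x := fun hh => a3 (hh b a4)
    rw [if_neg a1, if_neg this]

theorem row_sum (h : Cr G) (hn : 3 < Fintype.card V) {u : V} (hu : Br G u) (φ ψ : ℕ → ℕ)
    (h0 : ψ 0 = 0) (h1 : ψ 1 = φ 1) (h2 : ψ 2 = φ 0) (h3 : ψ 3 = φ 2) (h4 : ψ 4 = φ 1 + φ 2) :
    ∑ v, ψ (rank G u v) = ∑ w ∈ nb G u, φ (ty G w) := by
  classical
  simp only [h.rank_sum hn u _ φ ψ h0 h1 h2 h3 h4]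
  rw [← Finset.sum_product', ← Finset.sum_filter]
  symm
  have ex := fun w => h.tr_exists hn u w
  choose tt vv hT using ex
  refine Finset.sum_bij (fun w _ => (vv w, tt w)) ?_ ?_ ?_ ?_
  · intro w hw
    rw [mem_nb] at hw
    have hs : Sg G (tt w) u (vv w) := ⟨hu, w, hw, hT w⟩
    have := sg_le hs
    simp [hs]
    omega
  · intro w hw w' hw' he
    rw [mem_nb] at hw hw'
    rw [Prod.mk.injEq] at he
    have t1 := hT w
    rw [he.1, he.2] at t1
    exact h.tr_inj hn hu hw hw' t1 (hT w')
  · rintro ⟨v, t⟩ hvt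
    rw [Finset.mem_filter] at hvt
    obtain ⟨_, w, hw, ht⟩ := hvt.2
    refine ⟨w, mem_nb.2 hw, ?_⟩
    obtain ⟨r1, r2⟩ := h.tr_unique hu hw ht (hT w)
    simp only at r1 r2
    rw [r1, r2]
  · intro w hw
    rw [mem_nb] at hw
    rw [h.tr_ty hu hw (hT w)]

theorem row_NS (h : Cr G) (hn : 3 < Fintype.card V) {u : V} (hu : Br G u) :
    ∑ v, rNS (rank G u v) = (nb G u).card := by
  rw [h.row_sum hn hu (fun _ => 1) rNS rfl rfl rfl rfl rfl]
  simp

theorem tot_K (h : Cr G) (hn : 3 < Fintype.card V) [DecidablePred (Br G)] :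
    ∑ u with Br G u, ∑ v, rK (rank G u v) = 2 * (Finset.univ.filter (fun v => ¬ Br G v)).card := by
  classical
  have : ∑ u with Br G u, ∑ v, rK (rank G u v) = ∑ u with Br G u, ∑ w ∈ nb G u, ty G w := by
    apply Finset.sum_congr rfl
    intro u hu
    rw [Finset.mem_filter] at hu
    exact h.row_sum hn hu.2 (fun t => t) rK rfl rfl rfl rfl rfl
  rw [this]
  have e : ∀ u, ∑ w ∈ nb G u, ty G w = ∑ w, if G.Adj u w then ty G w else 0 := by
    intro u
    rw [nb, Finset.sum_filter]
  simp only [e]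
  rw [Finset.sum_comm]
  have e2 : ∀ w, ∑ u with Br G u, (if G.Adj u w then ty G w else 0) = if ¬ Br G w then 2 else 0 := by
    intro w
    rw [← Finset.sum_filter, Finset.sum_const, Finset.filter_filter, smul_eq_mul]
    by_cases hw : Br G w
    · simp [ty, hw]
    · rw [if_pos hw]
      obtain ⟨x, y, hxy, hx, hy, hz⟩ := h.nb_of_not_br hw
      by_cases hall : ∀ x, G.Adj w x → Br G x
      · have : (Finset.univ.filter (fun a => Br G a ∧ G.Adj a w)) = {x, y} := by
          ext z
          simp only [Finset.mem_filter, Finset.mem_univ, true_and, Finset.mem_insert,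
            Finset.mem_singleton]
          constructor
          · intro hh; exact hz z hh.2.symm
          · rintro (rfl | rfl)
            · exact ⟨hall _ hx, hx.symm⟩
            · exact ⟨hall _ hy, hy.symm⟩
        rw [this, Finset.card_pair hxy]
        rw [ty, if_neg hw, if_pos hall]
      · have : ∃ x y, Br G x ∧ ¬ Br G y ∧ G.Adj w x ∧ ∀ z, G.Adj w z → z = x ∨ z = y := by
          push Not at hall
          obtain ⟨p, hp, hpB⟩ := hall
          refine ⟨h.oth w p, p, ?_, hpB, h.oth_adj _ _, fun z hz => (h.oth_or hw hp hz).symm⟩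
          by_contra hb
          exact h.no_three hn hpB hw hb hp.symm (h.oth_adj _ _) (h.oth_ne _ _).symm
        obtain ⟨x, y, hxB, hyB, hx, hz⟩ := this
        have : (Finset.univ.filter (fun a => Br G a ∧ G.Adj a w)) = {x} := by
          ext z
          simp only [Finset.mem_filter, Finset.mem_univ, true_and, Finset.mem_singleton]
          constructor
          · rintro ⟨h1, h2⟩
            rcases hz z h2.symm with h3 | h3
            · exact h3
            · rw [h3] at h1; exact absurd h1 hyB
          · rintro rfl
            exact ⟨hxB, hx.symm⟩
        rw [this, Finset.card_singleton]
        rw [ty, if_neg hw, if_neg hall]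
  simp only [e2]
  rw [← Finset.sum_filter, Finset.sum_const, smul_eq_mul, mul_comm]

theorem tot_NS (h : Cr G) (hn : 3 < Fintype.card V) [DecidablePred (Br G)] :
    ∑ u with Br G u, ∑ v, rNS (rank G u v) + 2 * (Finset.univ.filter (fun v => ¬ Br G v)).card
      = 2 * G.edgeSet.ncard := by
  classical
  have e1 : ∑ u with Br G u, ∑ v, rNS (rank G u v) = ∑ u with Br G u, (nb G u).card := by
    apply Finset.sum_congr rfl
    intro u hu
    rw [Finset.mem_filter] at hu
    exact h.row_NS hn hu.2
  have e2 : 2 * (Finset.univ.filter (fun v => ¬ Br G v)).card = ∑ u with ¬ Br G u, (nb G u).card := by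
    rw [Finset.sum_congr rfl (g := fun _ => 2), Finset.sum_const, smul_eq_mul, mul_comm]
    intro u hu
    rw [Finset.mem_filter] at hu
    exact h.card_nb_of_not_br hu.2
  rw [e1, e2, Finset.sum_filter_add_sum_filter_not]
  have := G.sum_degrees_eq_twice_card_edges
  rw [← coe_edgeFinset, Set.ncard_coe_finset, ← this]
  apply Finset.sum_congr rfl
  intro u _
  rw [← card_neighborFinset_eq_degree]
  congr 1
  ext w
  simp [mem_nb]
end Cr

/-! ## Part 3: rank systems -/

/-- compatibility of a pair of colours with a rank -/
def okp (r : ℕ) (x y : Fin 5) : Prop := okd r (y - x).val = true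

instance (r : ℕ) : DecidableRel (okp r) := fun x y => by unfold okp; infer_instance

theorem okp_symm {r : ℕ} (hr : r ≤ 4) {x y : Fin 5} (h : okp r x y) : okp r y x := by
  unfold okp at *
  revert x y
  interval_cases r <;> decide

theorem okp_zero (x y : Fin 5) : okp 0 x y := rfl

structure RSys {W : Type} [Fintype W] (R : W → W → ℕ) : Prop where
  sym : ∀ u v, R u v = R v u
  diag : ∀ u, R u u = 0
  le4 : ∀ u v, R u v ≤ 4
  nc : ∀ g : W → Fin 5, ¬ ∀ u v, okp (R u v) (g u) (g v)
  cr : ∀ u v, R u v ≠ 0 → ∃ g : W → Fin 5, ∀ x y, s(x,y) ≠ s(u,v) → okp (R x y) (g x) (g y)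
  cr4 : ∀ u v, R u v = 4 → (∃ g : W → Fin 5, (∀ x y, s(x,y) ≠ s(u,v) → okp (R x y) (g x) (g y)) ∧
      g v = g u) ∧ (∃ g : W → Fin 5, (∀ x y, s(x,y) ≠ s(u,v) → okp (R x y) (g x) (g y)) ∧
      Cc (g u) (g v))
  deg3 : ∀ u, 3 ≤ ∑ v, rNS (R u v)

namespace Cr
variable {V : Type} [Fintype V] {G : SimpleGraph V}

theorem sum_sub [DecidablePred (Br G)] (ψ : ℕ → ℕ) (h0 : ψ 0 = 0) (u : V) :
    ∑ v : {v // Br G v}, ψ (rank G u v.1) = ∑ v, ψ (rank G u v) := by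
  have e : ∑ v : {v // Br G v}, ψ (rank G u v.1) = ∑ v with Br G v, ψ (rank G u v) := by
    rw [Finset.sum_subtype (Finset.univ.filter (Br G)) (p := Br G) (by simp)]
  rw [e]
  apply Finset.sum_subset (Finset.filter_subset _ _)
  intro v _ hv
  have : rank G u v = 0 := by
    by_contra hh
    exact hv (by simpa using (rank_br hh).2)
  rw [this, h0]

theorem rsys (h : Cr G) (hn : 3 < Fintype.card V) [DecidablePred (Br G)] :
    RSys (fun u v : {v // Br G v} => rank G u.1 v.1) := by
  have hcr : ∀ (t : ℕ) (u v : {v // Br G v}), Sg G t u.1 v.1 →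
      ∃ g : {v // Br G v} → Fin 5,
        (∀ x y, s(x,y) ≠ s(u,v) → okp (rank G x.1 y.1) (g x) (g y)) ∧
        (∀ t', t' ≠ t → Sg G t' u.1 v.1 → okt t' (g v - g u)) := by
    intro t u v hs
    obtain ⟨g, hg⟩ := h.sg_cr hs
    refine ⟨fun x => g x.1, ?_, ?_⟩
    · intro x y hxy
      apply ok_rank
      intro t' hs'
      apply hg t' _ _ hs'
      rintro ⟨_, he⟩
      apply hxy
      rw [Sym2.eq_iff] at he ⊢
      simpa [Subtype.ext_iff] using he
    · intro t' ht' hs'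
      exact hg t' _ _ hs' (fun hh => ht' hh.1)
  have hnc : ∀ g : {v // Br G v} → Fin 5, ¬ ∀ u v, okp (rank G u.1 v.1) (g u) (g v) := by
    intro g hg
    apply h.sg_nc hn (fun v => if hv : Br G v then g ⟨v, hv⟩ else 0)
    intro t u v hs
    obtain ⟨hu, hv⟩ := sg_br hs
    simp only [dif_pos hu, dif_pos hv]
    exact rank_ok u v _ (hg ⟨u, hu⟩ ⟨v, hv⟩) hs (fun a b => h.sg_ex01 hn a b)
      (fun a b => h.sg_ex02 hn a b)
  have hviol : ∀ (u v : {v // Br G v}) (g : {v // Br G v} → Fin 5),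
      (∀ x y, s(x,y) ≠ s(u,v) → okp (rank G x.1 y.1) (g x) (g y)) →
      ¬ okp (rank G u.1 v.1) (g u) (g v) := by
    intro u v g hg hh
    apply hnc g
    intro x y
    by_cases he : s(x,y) = s(u,v)
    · rw [Sym2.eq_iff] at he
      rcases he with ⟨rfl, rfl⟩ | ⟨rfl, rfl⟩
      · exact hh
      · rw [rank_symm]
        exact okp_symm (rank_le _ _) hh
    · exact hg x y he
  refine ⟨fun u v => rank_symm _ _, fun u => h.rank_self hn _, fun u v => rank_le _ _, hnc, ?_, ?_, ?_⟩
  · intro u v hne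
    have : ∃ t, Sg G t u.1 v.1 := by
      by_contra hh
      push Not at hh
      apply hne
      unfold rank
      simp [hh]
    obtain ⟨t, ht⟩ := this
    obtain ⟨g, hg, _⟩ := hcr t u v ht
    exact ⟨g, hg⟩
  · intro u v h4
    have h12 : Sg G 1 u.1 v.1 ∧ Sg G 2 u.1 v.1 := by
      simp only [rank] at h4
      by_cases h0 : Sg G 0 u.1 v.1
      · simp [h0] at h4
      · by_cases h1 : Sg G 1 u.1 v.1 <;> by_cases h2 : Sg G 2 u.1 v.1 <;> simp [h0, h1, h2] at h4 ⊢
    constructor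
    · obtain ⟨g, hg, hg'⟩ := hcr 2 u v h12.2
      refine ⟨g, hg, ?_⟩
      have a := hg' 1 (by omega) h12.1
      have b := hviol u v g hg
      have h4' : rank G u.1 v.1 = 4 := h4
      rw [h4'] at b
      revert a b
      generalize g u = p
      generalize g v = q
      unfold okt okp
      revert p q; decide
    · obtain ⟨g, hg, hg'⟩ := hcr 1 u v h12.1
      refine ⟨g, hg, ?_⟩
      have a := hg' 2 (by omega) h12.2
      have b := hviol u v g hg
      have h4' : rank G u.1 v.1 = 4 := h4
      rw [h4'] at b
      revert a b
      generalize g u = p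
      generalize g v = q
      unfold okt okp
      revert p q; decide
  · intro u
    rw [sum_sub rNS rfl, h.row_NS hn u.2]
    exact u.2

theorem rsum (h : Cr G) (hn : 3 < Fintype.card V) [DecidablePred (Br G)] {n : ℕ}
    (hV : Fintype.card V = n) (he : 4 * G.edgeSet.ncard + 2 = 5 * n) :
    ∑ u : {v // Br G v}, ∑ v : {v // Br G v}, rNS (rank G u.1 v.1)
      = 2 * (Fintype.card {v // Br G v} + (n-2)/4) ∧
    ∑ u : {v // Br G v}, ∑ v : {v // Br G v}, rK (rank G u.1 v.1)
      = 2 * (n - Fintype.card {v // Br G v}) := by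
  have hc : Fintype.card {v // Br G v} = (Finset.univ.filter (Br G)).card := Fintype.card_subtype _
  have hc2 : (Finset.univ.filter (Br G)).card + (Finset.univ.filter (fun v => ¬ Br G v)).card = n := by
    rw [Finset.card_filter_add_card_filter_not, Finset.card_univ, hV]
  have e : ∀ F : V → ℕ, ∑ u : {v // Br G v}, F u.1 = ∑ u with Br G u, F u := by
    intro F
    rw [Finset.sum_subtype (Finset.univ.filter (Br G)) (p := Br G) (by simp)]
  have s1 : ∑ u : {v // Br G v}, ∑ v : {v // Br G v}, rNS (rank G u.1 v.1)
      = ∑ u with Br G u, ∑ v, rNS (rank G u v) := by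
    simp only [sum_sub rNS rfl]
    exact e (fun u => ∑ v, rNS (rank G u v))
  have s2 : ∑ u : {v // Br G v}, ∑ v : {v // Br G v}, rK (rank G u.1 v.1)
      = ∑ u with Br G u, ∑ v, rK (rank G u v) := by
    simp only [sum_sub rK rfl]
    exact e (fun u => ∑ v, rK (rank G u v))
  have t1 := h.tot_NS hn
  have t2 := h.tot_K hn
  rw [s1, s2, hc]
  omega
end Cr

set_option synthInstance.maxHeartbeats 0 in
set_option synthInstance.maxSize 2000 in
theorem okp_tri (r1 r2 r3 : Fin 5) (hb : badT r1 r2 r3 = true)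
    (h0 : ∃ d e : Fin 5, okp r1 0 d ∧ okp r2 0 e ∧ okp r3 d e)
    (h1 : r1.val ≠ 0 → ∃ d e : Fin 5, ¬ okp r1 0 d ∧ okp r2 0 e ∧ okp r3 d e)
    (h2 : r2.val ≠ 0 → ∃ d e : Fin 5, okp r1 0 d ∧ ¬ okp r2 0 e ∧ okp r3 d e)
    (h3 : r3.val ≠ 0 → ∃ d e : Fin 5, okp r1 0 d ∧ okp r2 0 e ∧ ¬ okp r3 d e)
    (k1 : r1.val = 4 → (∃ e : Fin 5, okp r2 0 e ∧ okp r3 0 e) ∧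
      ∃ d e : Fin 5, Cc 0 d ∧ okp r2 0 e ∧ okp r3 d e)
    (k2 : r2.val = 4 → (∃ d : Fin 5, okp r1 0 d ∧ okp r3 d 0) ∧
      ∃ d e : Fin 5, Cc 0 e ∧ okp r1 0 d ∧ okp r3 d e)
    (k3 : r3.val = 4 → (∃ d : Fin 5, okp r1 0 d ∧ okp r2 0 d) ∧
      ∃ d e : Fin 5, Cc d e ∧ okp r1 0 d ∧ okp r2 0 e) : False := by
  revert r1 r2 r3
  decide +kernel

theorem okp_shift (r : ℕ) (x y z : Fin 5) : okp r (x - z) (y - z) ↔ okp r x y := by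
  unfold okp
  rw [sub_sub_sub_cancel_right]

theorem Cc_shift (x y z : Fin 5) : Cc (x - z) (y - z) ↔ Cc x y := by
  unfold Cc
  rw [sub_sub_sub_cancel_right]

theorem okp_card (r : Fin 5) (y : Fin 5) :
    (Finset.univ.filter (fun c : Fin 5 => ¬ okp r c y)).card = rZ r := by
  revert r y; decide

theorem okp_four (r1 r2 : Fin 5) (h1 : rNS r1 ≤ 1) (h2 : rNS r2 ≤ 1) (a b : Fin 5) :
    ∃ c d, okp r1 c a ∧ okp r2 d b ∧ okp 4 c d := by
  revert r1 r2 a b; decide +kernel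

namespace RSys
variable {W : Type} [Fintype W] {R : W → W → ℕ}

theorem viol (h : RSys R) {u v : W} {g : W → Fin 5}
    (hg : ∀ x y, s(x,y) ≠ s(u,v) → okp (R x y) (g x) (g y)) : ¬ okp (R u v) (g u) (g v) := by
  intro hh
  apply h.nc g
  intro x y
  by_cases he : s(x,y) = s(u,v)
  · rw [Sym2.eq_iff] at he
    rcases he with ⟨rfl, rfl⟩ | ⟨rfl, rfl⟩
    · exact hh
    · rw [h.sym]
      exact okp_symm (h.le4 _ _) hh
  · exact hg x y he

theorem recol (h : RSys R) {u : W} {g : W → Fin 5} (c : Fin 5)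
    (hg : ∀ x y, x ≠ u → y ≠ u → okp (R x y) (g x) (g y)) : ∃ w, w ≠ u ∧ ¬ okp (R u w) c (g w) := by
  classical
  by_contra hh
  push Not at hh
  apply h.nc (Function.update g u c)
  intro x y
  by_cases hx : x = u
  · by_cases hy : y = u
    · rw [hx, hy, h.diag]; exact okp_zero _ _
    · rw [hx, Function.update_self, Function.update_of_ne hy]
      exact hh y hy
  · by_cases hy : y = u
    · rw [hy, Function.update_self, Function.update_of_ne hx, h.sym]
      refine okp_symm (h.le4 _ _) (hh x hx)
    · rw [Function.update_of_ne hx, Function.update_of_ne hy]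
      exact hg x y hx hy

theorem exists_nb (h : RSys R) (u : W) : ∃ v, R u v ≠ 0 := by
  by_contra hh
  push Not at hh
  have := h.deg3 u
  simp [hh, rNS] at this

theorem ne_of (h : RSys R) {u v : W} (huv : R u v ≠ 0) : u ≠ v := by
  rintro rfl
  exact huv (h.diag u)

theorem off (h : RSys R) (u : W) : ∃ g : W → Fin 5, ∀ x y, x ≠ u → y ≠ u → okp (R x y) (g x) (g y) := by
  obtain ⟨v, hv⟩ := h.exists_nb u
  obtain ⟨g, hg⟩ := h.cr u v hv
  refine ⟨g, fun x y hx hy => hg x y ?_⟩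
  intro he
  rw [Sym2.eq_iff] at he
  tauto

theorem z5 (h : RSys R) (u : W) : 5 ≤ ∑ v, rZ (R u v) := by
  classical
  obtain ⟨g, hg⟩ := h.off u
  have hc : ∀ w, rZ (R u w) = (Finset.univ.filter (fun c : Fin 5 => ¬ okp (R u w) c (g w))).card := by
    intro w
    exact (okp_card ⟨R u w, by have := h.le4 u w; omega⟩ (g w)).symm
  simp only [hc]
  refine le_trans ?_ Finset.card_biUnion_le
  have : (Finset.univ : Finset (Fin 5)) ⊆
      Finset.univ.biUnion (fun w => Finset.univ.filter (fun c : Fin 5 => ¬ okp (R u w) c (g w))) := by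
    intro c _
    obtain ⟨w, _, hw⟩ := h.recol c hg
    simp only [Finset.mem_biUnion, Finset.mem_univ, true_and, Finset.mem_filter]
    exact ⟨w, hw⟩
  have := Finset.card_le_card this
  simpa using this

theorem one_other (h : RSys R) {u v : W} (h4 : R u v = 4) (hd : ∑ w, rNS (R u w) = 3) :
    ∃ x, x ≠ v ∧ x ≠ u ∧ rNS (R u x) ≤ 1 ∧ ∀ w, w ≠ v → w ≠ x → R u w = 0 := by
  classical
  have e := Finset.add_sum_erase Finset.univ (fun w => rNS (R u w)) (Finset.mem_univ v)
  have e4 : rNS (R u v) = 2 := by rw [h4]; rfl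
  simp only [e4] at e
  have e1 : ∑ w ∈ Finset.univ.erase v, rNS (R u w) = 1 := by omega
  obtain ⟨x, hx, hx0⟩ : ∃ x ∈ Finset.univ.erase v, rNS (R u x) ≠ 0 := by
    by_contra hh
    push Not at hh
    rw [Finset.sum_eq_zero hh] at e1
    omega
  have e2 := Finset.add_sum_erase _ (fun w => rNS (R u w)) hx
  have e3 : ∑ w ∈ (Finset.univ.erase v).erase x, rNS (R u w) = 0 := by omega
  rw [Finset.sum_eq_zero_iff] at e3
  refine ⟨x, (Finset.mem_erase.1 hx).1, ?_, by omega, ?_⟩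
  · rintro rfl
    rw [h.diag] at hx0
    exact hx0 rfl
  · intro w hw hwx
    have := e3 w (by simp [hw, hwx])
    have hl := h.le4 u w
    revert this
    generalize R u w = r at hl
    interval_cases r <;> simp [rNS]

theorem four_rule (h : RSys R) {u v : W} (h4 : R u v = 4) (hu : ∑ w, rNS (R u w) = 3)
    (hv : ∑ w, rNS (R v w) = 3) : False := by
  classical
  have huv : u ≠ v := h.ne_of (by omega)
  obtain ⟨x, hxv, hxu, hx1, hx0⟩ := h.one_other h4 hu
  obtain ⟨y, hyu, hyv, hy1, hy0⟩ := h.one_other (by rw [h.sym]; exact h4) hv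
  obtain ⟨g, hg⟩ := h.off u
  obtain ⟨c, d, hc, hd, hcd⟩ := okp_four ⟨R u x, by have := h.le4 u x; omega⟩
    ⟨R v y, by have := h.le4 v y; omega⟩ hx1 hy1 (g x) (g y)
  simp only at hc hd
  have key : ∃ w, w ≠ u ∧ ¬ okp (R u w) c (Function.update g v d w) := by
    apply h.recol c
    intro p q hp hq
    by_cases hpv : p = v
    · by_cases hqv : q = v
      · rw [hpv, hqv, h.diag]; exact okp_zero _ _
      · rw [hpv, Function.update_self, Function.update_of_ne hqv]
        by_cases hqy : q = y
        · rw [hqy]; exact hd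
        · rw [hy0 q hq hqy]; exact okp_zero _ _
    · by_cases hqv : q = v
      · rw [hqv, Function.update_self, Function.update_of_ne hpv]
        by_cases hpy : p = y
        · rw [hpy, h.sym]; exact okp_symm (h.le4 _ _) hd
        · rw [h.sym, hy0 p hp hpy]; exact okp_zero _ _
      · rw [Function.update_of_ne hpv, Function.update_of_ne hqv]
        exact hg p q hp hq
  obtain ⟨w, hw, hw2⟩ := key
  apply hw2
  by_cases hwv : w = v
  · rw [hwv, Function.update_self, h4]; exact hcd
  · rw [Function.update_of_ne hwv]
    by_cases hwx : w = x
    · rw [hwx]; exact hc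
    · rw [hx0 w hwv hwx]; exact okp_zero _ _

theorem cross (h : RSys R) (S : W → Prop) {a b : W} (ha : S a) (hb : ¬ S b) :
    ∃ i j, S i ∧ ¬ S j ∧ R i j ≠ 0 := by
  classical
  by_contra hh
  push Not at hh
  obtain ⟨v, hv⟩ := h.exists_nb a
  obtain ⟨w, hw⟩ := h.exists_nb b
  have hvS : S v := by
    by_contra hc
    exact hv (hh a v ha hc)
  have hwS : ¬ S w := by
    intro hc
    exact hw (by rw [h.sym]; exact hh w b hc hb)
  obtain ⟨g1, hg1⟩ := h.cr a v hv
  obtain ⟨g2, hg2⟩ := h.cr b w hw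
  apply h.nc (fun x => if S x then g2 x else g1 x)
  intro x y
  by_cases hx : S x <;> by_cases hy : S y <;> simp only [hx, hy, if_true, if_false]
  · apply hg2
    intro he
    rw [Sym2.eq_iff] at he
    rcases he with ⟨rfl, rfl⟩ | ⟨rfl, rfl⟩ <;> tauto
  · rw [hh x y hx hy]; exact okp_zero _ _
  · rw [h.sym, hh y x hy hx]; exact okp_zero _ _
  · apply hg1
    intro he
    rw [Sym2.eq_iff] at he
    rcases he with ⟨rfl, rfl⟩ | ⟨rfl, rfl⟩ <;> tauto

theorem tri (h : RSys R) {a b c z : W} (hab : a ≠ b) (hac : a ≠ c) (hbc : b ≠ c)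
    (hza : z ≠ a) (hzb : z ≠ b) (hzc : z ≠ c) : badT (R a b) (R a c) (R b c) = false := by
  by_contra hbad
  rw [Bool.not_eq_false] at hbad
  have n1 : s(a,c) ≠ s(a,b) := by simp; tauto
  have n2 : s(b,c) ≠ s(a,b) := by simp; tauto
  have n3 : s(b,c) ≠ s(a,c) := by simp; tauto
  have A : ∀ g : W → Fin 5, ∀ x y, okp (R x y) (g x) (g y) → okp (R x y) (g x - g a) (g y - g a) :=
    fun g x y hh => (okp_shift _ _ _ _).2 hh
  have A' : ∀ g : W → Fin 5, ∀ y, okp (R a y) (g a) (g y) → okp (R a y) 0 (g y - g a) := by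
    intro g y hh
    have := A g a y hh
    rwa [sub_self] at this
  refine okp_tri ⟨R a b, by have := h.le4 a b; omega⟩ ⟨R a c, by have := h.le4 a c; omega⟩
    ⟨R b c, by have := h.le4 b c; omega⟩ hbad ?_ ?_ ?_ ?_ ?_ ?_ ?_ <;> simp only
  · obtain ⟨g, hg⟩ := h.off z
    exact ⟨g b - g a, g c - g a, A' g b (hg a b hza.symm hzb.symm), A' g c (hg a c hza.symm hzc.symm),
      A g b c (hg b c hzb.symm hzc.symm)⟩
  · intro hne
    obtain ⟨g, hg⟩ := h.cr a b hne
    refine ⟨g b - g a, g c - g a, ?_, A' g c (hg a c n1), A g b c (hg b c n2)⟩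
    have := h.viol hg
    rwa [← okp_shift _ _ _ (g a), sub_self] at this
  · intro hne
    obtain ⟨g, hg⟩ := h.cr a c hne
    refine ⟨g b - g a, g c - g a, A' g b (hg a b n1.symm), ?_, A g b c (hg b c n3)⟩
    have := h.viol hg
    rwa [← okp_shift _ _ _ (g a), sub_self] at this
  · intro hne
    obtain ⟨g, hg⟩ := h.cr b c hne
    refine ⟨g b - g a, g c - g a, A' g b (hg a b n2.symm), A' g c (hg a c n3.symm), ?_⟩
    have := h.viol hg
    rwa [← okp_shift _ _ _ (g a)] at this
  · intro h4
    obtain ⟨⟨g, hg, he⟩, ⟨g', hg', he'⟩⟩ := h.cr4 a b h4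
    refine ⟨⟨g c - g a, A' g c (hg a c n1), ?_⟩, ⟨g' b - g' a, g' c - g' a, ?_, A' g' c (hg' a c n1),
      A g' b c (hg' b c n2)⟩⟩
    · have := A g b c (hg b c n2)
      rwa [he, sub_self] at this
    · have := (Cc_shift _ _ (g' a)).2 he'
      rwa [sub_self] at this
  · intro h4
    obtain ⟨⟨g, hg, he⟩, ⟨g', hg', he'⟩⟩ := h.cr4 a c h4
    refine ⟨⟨g b - g a, A' g b (hg a b n1.symm), ?_⟩, ⟨g' b - g' a, g' c - g' a, ?_,
      A' g' b (hg' a b n1.symm), A g' b c (hg' b c n3)⟩⟩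
    · have := A g b c (hg b c n3)
      rwa [he, sub_self] at this
    · have := (Cc_shift _ _ (g' a)).2 he'
      rwa [sub_self] at this
  · intro h4
    obtain ⟨⟨g, hg, he⟩, ⟨g', hg', he'⟩⟩ := h.cr4 b c h4
    refine ⟨⟨g b - g a, A' g b (hg a b n2.symm), ?_⟩, ⟨g' b - g' a, g' c - g' a, ?_,
      A' g' b (hg' a b n2.symm), A' g' c (hg' a c n3.symm)⟩⟩
    · have := A' g c (hg a c n3.symm)
      rwa [he] at this
    · exact (Cc_shift _ _ (g' a)).2 he'
end RSys

namespace RSys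
variable {W : Type} [Fintype W] {R : W → W → ℕ} {N : ℕ}

/-- the matrix of a labelling -/
def mx (R : W → W → ℕ) (e : Fin N ≃ W) (i j : ℕ) : ℕ :=
  if h : i < N ∧ j < N then R (e ⟨i, h.1⟩) (e ⟨j, h.2⟩) else 0

theorem mx_of (e : Fin N ≃ W) {i j : ℕ} (hi : i < N) (hj : j < N) :
    mx R e i j = R (e ⟨i, hi⟩) (e ⟨j, hj⟩) := dif_pos ⟨hi, hj⟩

theorem mx_rowS (e : Fin N ≃ W) (φ : ℕ → ℕ) {i : ℕ} (hi : i < N) :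
    rowS N (mx R e) φ i = ∑ w, φ (R (e ⟨i, hi⟩) w) := by
  unfold rowS
  rw [Finset.sum_range, ← Equiv.sum_comp e]
  apply Finset.sum_congr rfl
  intro j _
  rw [mx_of e hi j.2]

theorem mx_sum (e : Fin N ≃ W) (φ : ℕ → ℕ) :
    ∑ i ∈ Finset.range N, rowS N (mx R e) φ i = ∑ u, ∑ w, φ (R u w) := by
  rw [Finset.sum_range, ← Equiv.sum_comp e]
  apply Finset.sum_congr rfl
  intro i _
  rw [mx_rowS e φ i.2]

/-- the key that a labelling has to maximise -/
def key (R : W → W → ℕ) (e : Fin N ≃ W) (z : Fin N) : Lex (ℕ → ℕ) := toLex fun k =>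
  if k = 0 then ∑ w, rCode (R (e z) w)
  else if (k - 1) / N < (k - 1) % N then mx R e ((k - 1) / N) ((k - 1) % N) else 0

theorem key_lt {e e' : Fin N ≃ W} {z : Fin N} (k : ℕ)
    (h1 : ∀ j < k, ofLex (key R e z) j = ofLex (key R e' z) j)
    (h2 : ofLex (key R e z) k < ofLex (key R e' z) k) : key R e z < key R e' z := ⟨k, h1, h2⟩

theorem exists_max (e0 : Fin N ≃ W) (z : Fin N) : ∃ e : Fin N ≃ W, ∀ e', ¬ key R e z < key R e' z := by
  have : Nonempty (Fin N ≃ W) := ⟨e0⟩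
  obtain ⟨e, he⟩ := Finite.exists_max (fun e : Fin N ≃ W => key R e z)
  exact ⟨e, fun e' => not_lt.2 (he e')⟩

theorem code_rule {e : Fin N ≃ W} {z : Fin N} (he : ∀ e', ¬ key R e z < key R e' z) (v : Fin N) :
    ∑ w, rCode (R (e v) w) ≤ ∑ w, rCode (R (e z) w) := by
  by_contra hlt
  push Not at hlt
  apply he ((Equiv.swap z v).trans e)
  apply key_lt 0
  · intro j hj; omega
  · simpa [key] using hlt

theorem tie_rule {e : Fin N ≃ W} {z : Fin N} (hz : z.val = 0)
    (he : ∀ e', ¬ key R e z < key R e' z) {i j : ℕ} (hij : i + 1 < j) (hj : j < N)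
    (hp : ∀ i' < i, mx R e i' j = mx R e i' (j-1)) : mx R e i j ≤ mx R e i (j-1) := by
  by_contra hlt
  push Not at hlt
  have hj1 : j - 1 < N := by omega
  set e' : Fin N ≃ W := (Equiv.swap ⟨j-1, hj1⟩ ⟨j, hj⟩).trans e with he'
  have fix : ∀ r (hr : r < N), r ≠ j - 1 → r ≠ j → e' ⟨r, hr⟩ = e ⟨r, hr⟩ := by
    intro r hr h1 h2
    rw [he', Equiv.trans_apply, Equiv.swap_apply_of_ne_of_ne] <;> rw [Ne, Fin.mk.injEq] <;> assumption
  have fl : e' ⟨j-1, hj1⟩ = e ⟨j, hj⟩ := by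
    rw [he', Equiv.trans_apply, Equiv.swap_apply_left]
  have fr : e' ⟨j, hj⟩ = e ⟨j-1, hj1⟩ := by
    rw [he', Equiv.trans_apply, Equiv.swap_apply_right]
  have hd : (i * N + (j-1)) / N = i := by
    rw [mul_comm, Nat.mul_add_div (by omega), Nat.div_eq_of_lt hj1]; omega
  have hm : (i * N + (j-1)) % N = j - 1 := by
    rw [mul_comm, Nat.mul_add_mod, Nat.mod_eq_of_lt hj1]
  apply he e'
  apply key_lt (1 + (i * N + (j-1)))
  · intro k hk
    simp only [key, ofLex_toLex]
    by_cases hk0 : k = 0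
    · simp only [hk0, if_true]
      have : e' z = e z := fix z.1 z.2 (by omega) (by omega)
      rw [this]
    · simp only [hk0, if_false]
      by_cases hrc : (k-1)/N < (k-1) % N
      · simp only [hrc, if_true]
        have hc : (k-1) % N < N := Nat.mod_lt _ (by omega)
        have hdm := Nat.div_add_mod (k-1) N
        generalize (k-1)/N = r at *
        generalize (k-1)%N = c at *
        have hri : r < i ∨ (r = i ∧ c < j - 1) := by
          rcases lt_trichotomy r i with h | h | h
          · exact Or.inl h
          · refine Or.inr ⟨h, ?_⟩
            subst h
            rw [mul_comm] at hdm
            omega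
          · exfalso
            have : (i+1) * N ≤ r * N := Nat.mul_le_mul_right N h
            rw [Nat.add_mul] at this
            rw [mul_comm] at hdm
            omega
        have hrN : r < N := by omega
        rw [mx_of e hrN hc, mx_of e' hrN hc, fix r hrN (by omega) (by omega)]
        by_cases c1 : c = j - 1
        · have hr : r < i := by omega
          have := hp r hr
          rw [mx_of e hrN hj, mx_of e hrN hj1] at this
          subst c1
          rw [fl, this]
        · by_cases c2 : c = j
          · have hr : r < i := by omega
            have := hp r hr
            rw [mx_of e hrN hj, mx_of e hrN hj1] at this
            subst c2
            rw [fr, this]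
          · rw [fix c hc c1 c2]
      · simp only [hrc, if_false]
  · simp only [key, ofLex_toLex]
    have e1 : ¬ (1 + (i * N + (j-1)) = 0) := by omega
    have e2 : 1 + (i * N + (j-1)) - 1 = i * N + (j-1) := by omega
    have e3 : i < j - 1 := by omega
    simp only [e1, if_false, e2, hd, hm, e3, if_true]
    have hiN : i < N := by omega
    rw [mx_of e hiN hj1, mx_of e' hiN hj1, fl, fix i hiN (by omega) (by omega)]
    rw [mx_of e hiN hj, mx_of e hiN hj1] at hlt
    exact hlt

theorem code_deg (h : RSys R) (hW : Fintype.card W ≤ 8) {u v : W}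
    (hc : ∑ w, rCode (R u w) ≤ ∑ w, rCode (R v w)) : ∑ w, rNS (R u w) ≤ ∑ w, rNS (R v w) := by
  have low : ∀ v, ∃ l, l < 65536 ∧ ∑ w, rCode (R v w) = 65536 * ∑ w, rNS (R v w) + l := by
    intro v
    refine ⟨∑ w, [0,1,16,256,4096].getD (R v w) 0, ?_, ?_⟩
    · have : ∑ w, [0,1,16,256,4096].getD (R v w) 0 ≤ ∑ w : W, 4096 := by
        apply Finset.sum_le_sum
        intro u _
        have h4 := h.le4 v u
        generalize R v u = r at *
        interval_cases r <;> decide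
      rw [Finset.sum_const, Finset.card_univ, smul_eq_mul] at this
      omega
    · rw [Finset.mul_sum, ← Finset.sum_add_distrib]
      apply Finset.sum_congr rfl
      intro u _
      have h4 := h.le4 v u
      generalize R v u = r at *
      interval_cases r <;> decide
  obtain ⟨l, hl, e⟩ := low u
  obtain ⟨l', hl', e'⟩ := low v
  omega

theorem good (h : RSys R) {n : ℕ} (hW : Fintype.card W = N) (h3 : 3 ≤ N) (h8 : N ≤ 8) (hn : n ≤ 18)
    (s1 : ∑ u, ∑ v, rNS (R u v) = 2 * (N + (n-2)/4)) (s2 : ∑ u, ∑ v, rK (R u v) = 2 * (n - N)) :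
    ∃ e : Fin N ≃ W, Good n N (mx R e) := by
  classical
  obtain ⟨e, he⟩ := exists_max (R := R) (Fintype.equivFinOfCardEq hW).symm ⟨0, by omega⟩
  refine ⟨e, ?_⟩
  have code : ∀ v : Fin N, ∑ w, rCode (R (e v) w) ≤ ∑ w, rCode (R (e ⟨0, by omega⟩) w) := code_rule he
  have dmax : ∀ v : Fin N, ∑ w, rNS (R (e v) w) ≤ ∑ w, rNS (R (e ⟨0, by omega⟩) w) :=
    fun v => h.code_deg (by omega) (code v)
  have hle : ∀ i j, mx R e i j ≤ 4 := by
    intro i j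
    unfold mx
    split_ifs
    · exact h.le4 _ _
    · omega
  have htop : ∀ i j, i < j → j < N → mx R e i j ≤ topR n N i := by
    intro i j hij hj
    have hi : i < N := by omega
    unfold topR
    split_ifs with hc
    · exact hle i j
    · push Not at hc
      by_contra hgt
      have h4 : R (e ⟨i, hi⟩) (e ⟨j, hj⟩) = 4 := by
        have := hle i j
        rw [mx_of e hi hj] at this hgt
        omega
      have hsum : ∑ v : Fin N, ∑ w, rNS (R (e v) w) = 2 * (N + (n-2)/4) := by
        rw [← s1, ← Equiv.sum_comp e]
      have hd : ∀ v : Fin N, 3 ≤ ∑ w, rNS (R (e v) w) := fun v => h.deg3 _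
      generalize hF : (fun v : Fin N => ∑ w, rNS (R (e v) w)) = F at *
      have hFv : ∀ v, ∑ w, rNS (R (e v) w) = F v := fun v => by rw [← hF]
      simp only [hFv] at hsum hd dmax
      have hsub : ∀ a b : Fin N, a ≠ b → F a + F b + 3 * (N - 2) ≤ 2 * (N + (n-2)/4) := by
        intro a b hab
        rw [← hsum, ← Finset.add_sum_erase _ F (Finset.mem_univ a),
          ← Finset.add_sum_erase _ F (a := b) (by simp [hab.symm])]
        have : ∑ x ∈ (Finset.univ.erase a).erase b, 3 ≤ ∑ x ∈ (Finset.univ.erase a).erase b, F x :=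
          Finset.sum_le_sum (fun x _ => hd x)
        rw [Finset.sum_const, Finset.card_erase_of_mem (by simp [hab.symm]),
          Finset.card_erase_of_mem (by simp), Finset.card_univ, Fintype.card_fin, smul_eq_mul] at this
        omega
      apply h.four_rule h4
      · rw [hFv]
        have a1 := hsub ⟨i, hi⟩ ⟨j, hj⟩ (by simp; omega)
        have a2 := hd ⟨i, hi⟩
        have a3 := hd ⟨j, hj⟩
        by_cases hi0 : i = 0
        · omega
        · have a4 := hsub ⟨0, by omega⟩ ⟨i, hi⟩ (by simp; omega)
          have a5 := dmax ⟨i, hi⟩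
          omega
      · rw [hFv]
        have a1 := hsub ⟨i, hi⟩ ⟨j, hj⟩ (by simp; omega)
        have a2 := hd ⟨i, hi⟩
        have a3 := hd ⟨j, hj⟩
        by_cases hi0 : i = 0
        · omega
        · have a4 := hsub ⟨0, by omega⟩ ⟨j, hj⟩ (by simp; omega)
          have a5 := dmax ⟨j, hj⟩
          omega
  have hne : ∀ i j (hi : i < N) (hj : j < N), i ≠ j → e ⟨i, hi⟩ ≠ e ⟨j, hj⟩ := by
    intro i j hi hj hij hh
    have := e.injective hh
    rw [Fin.mk.injEq] at this
    exact hij this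
  refine { N8 := h8, le4 := hle, top := htop, tie := ?_, tri := ?_, N3 := h3, n18 := hn, sym := ?_,
           diag := ?_, sumNS := ?_, sumK := ?_, deg3 := ?_, z5 := ?_, code := ?_, cross := ?_ }
  · intro i j hij hj hp
    exact tie_rule rfl he hij hj hp
  · intro h4 i j k hij hjk hk
    have hj : j < N := by omega
    have hi : i < N := by omega
    rw [mx_of e hi hj, mx_of e hi hk, mx_of e hj hk]
    obtain ⟨z, hz⟩ : ∃ z, z ∉ ({e ⟨i, hi⟩, e ⟨j, hj⟩, e ⟨k, hk⟩} : Finset W) := by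
      by_contra hh
      push Not at hh
      have h1 := Finset.card_le_card (fun x (_ : x ∈ Finset.univ) => hh x)
      have h2 := Finset.card_le_three (a := e ⟨i, hi⟩) (b := e ⟨j, hj⟩) (c := e ⟨k, hk⟩)
      rw [Finset.card_univ] at h1
      omega
    simp only [Finset.mem_insert, Finset.mem_singleton, not_or] at hz
    exact h.tri (hne _ _ _ _ (by omega)) (hne _ _ _ _ (by omega)) (hne _ _ _ _ (by omega))
      hz.1 hz.2.1 hz.2.2
  · intro i j
    unfold mx
    by_cases hh : i < N ∧ j < N
    · rw [dif_pos hh, dif_pos ⟨hh.2, hh.1⟩, h.sym]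
    · rw [dif_neg hh, dif_neg (fun h' => hh ⟨h'.2, h'.1⟩)]
  · intro i
    unfold mx
    split_ifs
    · exact h.diag _
    · rfl
  · rw [mx_sum, s1]
  · rw [mx_sum, s2]
  · intro v hv
    rw [mx_rowS e _ hv]
    exact h.deg3 _
  · intro v hv
    rw [mx_rowS e _ hv]
    exact h.z5 _
  · intro v hv
    rw [mx_rowS e _ hv, mx_rowS e _ (show 0 < N by omega)]
    exact code _
  · intro v hv
    obtain ⟨a, b, ha, hb, hab⟩ := h.cross (fun w => (e.symm w).val ≤ v) (a := e ⟨0, by omega⟩)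
      (b := e ⟨v+1, hv⟩) (by simp) (by simp)
    refine ⟨(e.symm a).val, (e.symm b).val, ha, by omega, (e.symm b).2, ?_⟩
    rw [mx_of e (e.symm a).2 (e.symm b).2]
    simpa using hab

theorem bounds (h : RSys R) {n : ℕ} (hW : Fintype.card W = N) (n6 : 6 ≤ n) (hn : n ≤ 18)
    (s1 : ∑ u, ∑ v, rNS (R u v) = 2 * (N + (n-2)/4)) : 3 ≤ N ∧ N ≤ (n-2)/2 := by
  classical
  constructor
  · have hpos : 0 < N := by
      by_contra h0
      have : IsEmpty W := Fintype.card_eq_zero_iff.1 (by omega)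
      simp at s1
      omega
    obtain ⟨u⟩ : Nonempty W := Fintype.card_pos_iff.1 (by omega)
    have e := Finset.add_sum_erase Finset.univ (fun w => rNS (R u w)) (Finset.mem_univ u)
    have h3 := h.deg3 u
    have e0 : rNS (R u u) = 0 := by rw [h.diag]; rfl
    have : ∑ w ∈ Finset.univ.erase u, rNS (R u w) ≤ ∑ w ∈ Finset.univ.erase u, 2 := by
      apply Finset.sum_le_sum
      intro w _
      have h4 := h.le4 u w
      generalize R u w = r at *
      interval_cases r <;> decide
    rw [Finset.sum_const, Finset.card_erase_of_mem (by simp), Finset.card_univ, hW, smul_eq_mul] at this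
    omega
  · have : ∑ u : W, 3 ≤ ∑ u, ∑ v, rNS (R u v) := Finset.sum_le_sum (fun u _ => h.deg3 u)
    rw [Finset.sum_const, Finset.card_univ, hW, smul_eq_mul, s1] at this
    omega
end RSys

/-! ## Part 4: the two exceptional graphs -/

/-- a noncolourable graph mapping to a critical one of the same order is isomorphic to it -/
theorem iso_of_hom {V : Type} [Fintype V] {G : SimpleGraph V} (h : Critical52 G)
    {E : SimpleGraph (Fin 10)} (hc : Fintype.card V = 10)
    (hE : ∀ f : Fin 10 → Fin 5, ¬ ∀ i j, E.Adj i j → Cc (f i) (f j))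
    (φ : Fin 10 → V) (hφ : ∀ i j, E.Adj i j → G.Adj (φ i) (φ j)) : Nonempty (G ≃g E) := by
  let H : G.Subgraph :=
    { verts := Set.range φ
      Adj := fun a b => ∃ i j, E.Adj i j ∧ φ i = a ∧ φ j = b
      adj_sub := by
        rintro a b ⟨i, j, hij, rfl, rfl⟩
        exact hφ i j hij
      edge_vert := by
        rintro a b ⟨i, j, hij, rfl, rfl⟩
        exact ⟨i, rfl⟩
      symm := ⟨by
        rintro a b ⟨i, j, hij, rfl, rfl⟩
        exact ⟨j, i, hij.symm, rfl, rfl⟩⟩ }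
  have hH : H = ⊤ := by
    by_contra hne
    obtain ⟨f⟩ := h.2 H hne
    apply hE (fun i => f ⟨φ i, ⟨i, rfl⟩⟩)
    intro i j hij
    rw [← Cc_iff]
    apply f.map_rel
    exact ⟨i, j, hij, rfl, rfl⟩
  have hs : Function.Surjective φ := by
    intro v
    have : v ∈ H.verts := by rw [hH]; trivial
    exact this
  have hb : Function.Bijective φ := by
    rw [Fintype.bijective_iff_surjective_and_card]
    exact ⟨hs, by simp [hc]⟩
  refine ⟨(⟨Equiv.ofBijective φ hb, ?_⟩ : E ≃g G).symm⟩
  intro i j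
  constructor
  · intro hij
    have : H.Adj (φ i) (φ j) := by rw [hH]; exact hij
    obtain ⟨i', j', hh, e1, e2⟩ := this
    rw [← hb.1 e1, ← hb.1 e2]
    exact hh
  · exact hφ i j

theorem Cc_p3 {a b c d : Fin 5} (h1 : Cc a b) (h2 : Cc b c) (h3 : Cc c d) : a ≠ d := by
  revert a b c d; decide +kernel

theorem Cc_star {a b c w : Fin 5} (h1 : Cc w a) (h2 : Cc w b) (h3 : Cc w c) (hab : a ≠ b)
    (hbc : b ≠ c) (hac : c ≠ a) : False := by
  revert a b c w; decide +kernel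

theorem Cc_c5 {a b c d e : Fin 5} (h1 : Cc a b) (h2 : Cc b c) (h3 : Cc c d) (h4 : Cc d e)
    (h5 : Cc e a) : d = 3 * (a + b) := by
  revert a b c d e; decide +kernel

theorem E1_nc (f : Fin 10 → Fin 5) : ¬ ∀ i j, E1.Adj i j → Cc (f i) (f j) := by
  intro h
  have a : ∀ i j, s(i,j) ∈ ({s(0,1), s(1,2), s(2,3), s(3,4), s(4,5), s(5,6), s(6,7), s(7,8), s(8,0),
   s(9,0), s(9,3), s(9,6)} : Set (Sym2 (Fin 10))) → i ≠ j → Cc (f i) (f j) :=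
    fun i j h1 h2 => h i j ((fromEdgeSet_adj _).2 ⟨h1, h2⟩)
  exact Cc_star (a 9 0 (by simp) (by decide)) (a 9 3 (by simp) (by decide)) (a 9 6 (by simp) (by decide))
    (Cc_p3 (a 0 1 (by simp) (by decide)) (a 1 2 (by simp) (by decide)) (a 2 3 (by simp) (by decide)))
    (Cc_p3 (a 3 4 (by simp) (by decide)) (a 4 5 (by simp) (by decide)) (a 5 6 (by simp) (by decide)))
    (Cc_p3 (a 6 7 (by simp) (by decide)) (a 7 8 (by simp) (by decide)) (a 8 0 (by simp) (by decide)))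

theorem E2_nc (f : Fin 10 → Fin 5) : ¬ ∀ i j, E2.Adj i j → Cc (f i) (f j) := by
  intro h
  have a : ∀ i j, s(i,j) ∈ ({s(0,1), s(1,2), s(2,3), s(3,4), s(4,0),
   s(1,5), s(5,6), s(6,7), s(7,0), s(3,8), s(8,9), s(9,6)} : Set (Sym2 (Fin 10))) → i ≠ j →
     Cc (f i) (f j) :=
    fun i j h1 h2 => h i j ((fromEdgeSet_adj _).2 ⟨h1, h2⟩)
  have a01 := a 0 1 (by simp) (by decide)
  have e3 := Cc_c5 a01 (a 1 2 (by simp) (by decide)) (a 2 3 (by simp) (by decide))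
    (a 3 4 (by simp) (by decide)) (a 4 0 (by simp) (by decide))
  have e6 := Cc_c5 a01 (a 1 5 (by simp) (by decide)) (a 5 6 (by simp) (by decide))
    (a 6 7 (by simp) (by decide)) (a 7 0 (by simp) (by decide))
  apply Cc_p3 (a 3 8 (by simp) (by decide)) (a 8 9 (by simp) (by decide)) (a 9 6 (by simp) (by decide))
  rw [e3, e6]

namespace Cr
variable {V : Type} [Fintype V] {G : SimpleGraph V}

theorem adj_of_rank {u v : V} (h : rank G u v = 2) : G.Adj u v := by
  have : Sg G 0 u v := by
    by_contra h0
    unfold rank at h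
    rw [if_neg h0] at h
    split_ifs at h <;> omega
  obtain ⟨_, w, hw, ⟨_, _, rfl⟩ | ⟨e, _⟩ | ⟨e, _⟩⟩ := this
  · exact hw
  · omega
  · omega

theorem path_of_rank {u v : V} (h : rank G u v = 1) : ∃ w, G.Adj u w ∧ G.Adj w v := by
  have : Sg G 1 u v := by
    by_contra h0
    unfold rank at h
    rw [if_neg h0] at h
    split_ifs at h <;> omega
  obtain ⟨_, w, hw, ⟨e, _⟩ | ⟨_, _, _, hv, _⟩ | ⟨e, _⟩⟩ := this
  · omega
  · exact ⟨w, hw, hv⟩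
  · omega

theorem path2_of_rank {u v : V} (h : rank G u v = 3) : ∃ w b, G.Adj u w ∧ G.Adj w b ∧ G.Adj b v := by
  have : Sg G 2 u v := by
    by_contra h0
    unfold rank at h
    simp only [h0, if_false] at h
    split_ifs at h <;> omega
  obtain ⟨_, w, hw, ⟨e, _⟩ | ⟨e, _⟩ | ⟨_, _, _, b, _, h1, h2⟩⟩ := this
  · omega
  · omega
  · exact ⟨w, b, hw, h1, h2⟩
end Cr

theorem E1_hom {V : Type} {G : SimpleGraph V} (φ : Fin 10 → V)
    (a : ∀ p ∈ ([(0,1), (1,2), (2,3), (3,4), (4,5), (5,6), (6,7), (7,8), (8,0),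
     (9,0), (9,3), (9,6)] : List (Fin 10 × Fin 10)), G.Adj (φ p.1) (φ p.2)) (i j : Fin 10)
    (h : E1.Adj i j) : G.Adj (φ i) (φ j) := by
  simp only [List.forall_mem_cons, List.not_mem_nil, false_imp_iff, forall_const, and_true] at a
  rw [E1, fromEdgeSet_adj] at h
  obtain ⟨h, _⟩ := h
  simp only [Set.mem_insert_iff, Set.mem_singleton_iff, Sym2.eq_iff] at h
  have b := a
  simp only [G.adj_comm (φ _) (φ _)] at b
  rcases h with h | h | h | h | h | h | h | h | h | h | h | h <;>
    rcases h with ⟨rfl, rfl⟩ | ⟨rfl, rfl⟩ <;> tauto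

theorem E2_hom {V : Type} {G : SimpleGraph V} (φ : Fin 10 → V)
    (a : ∀ p ∈ ([(0,1), (1,2), (2,3), (3,4), (4,0), (1,5), (5,6), (6,7), (7,0), (3,8), (8,9),
     (9,6)] : List (Fin 10 × Fin 10)), G.Adj (φ p.1) (φ p.2)) (i j : Fin 10)
    (h : E2.Adj i j) : G.Adj (φ i) (φ j) := by
  simp only [List.forall_mem_cons, List.not_mem_nil, false_imp_iff, forall_const, and_true] at a
  rw [E2, fromEdgeSet_adj] at h
  obtain ⟨h, _⟩ := h
  simp only [Set.mem_insert_iff, Set.mem_singleton_iff, Sym2.eq_iff] at h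
  rcases h with h | h | h | h | h | h | h | h | h | h | h | h <;>
    rcases h with ⟨rfl, rfl⟩ | ⟨rfl, rfl⟩ <;> tauto

theorem exc_iso {V : Type} [Fintype V] {G : SimpleGraph V} (h : Critical52 G)
    (hc : Fintype.card V = 10) (w : Fin 4 → V) (M : ℕ → ℕ → ℕ) (hM4 : ∀ i j, M i j ≤ 4)
    (hM : ∀ i j : Fin 4, M i j = Cr.rank G (w i) (w j)) {P : ℕ}
    (hP : P ∈ [141976870852339152092993259831296, 81367322902204815222265742360576])
    (hb : ∀ b, P.testBit b = true ↔ ∃ i j, i < j ∧ j < 4 ∧ M i j ≠ 0 ∧ b = 32*j + 8*(M i j - 1) + i) :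
    Nonempty (G ≃g E1) ∨ Nonempty (G ≃g E2) := by
  have get : ∀ (i j : Fin 4) (r : ℕ), r < 4 → P.testBit (32 * j.val + 8 * r + i.val) = true →
      Cr.rank G (w i) (w j) = r + 1 := by
    intro i j r hr ht
    obtain ⟨i', j', h1, h2, h3, h4⟩ := (hb _).1 ht
    have := hM4 i' j'
    have e1 : i' = i.val := by omega
    have e2 : j' = j.val := by omega
    subst e1 e2
    rw [← hM]
    omega
  simp only [List.mem_cons, List.not_mem_nil, or_false] at hP
  rcases hP with rfl | rfl
  · left
    obtain ⟨p1, p2, h1, h2, h3⟩ := Cr.path2_of_rank (get 0 1 2 (by decide) (by decide))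
    obtain ⟨q1, q2, k1, k2, k3⟩ := Cr.path2_of_rank (get 1 2 2 (by decide) (by decide))
    obtain ⟨r1, r2, l1, l2, l3⟩ := Cr.path2_of_rank (get 0 2 2 (by decide) (by decide))
    have m1 := Cr.adj_of_rank (get 0 3 1 (by decide) (by decide))
    have m2 := Cr.adj_of_rank (get 1 3 1 (by decide) (by decide))
    have m3 := Cr.adj_of_rank (get 2 3 1 (by decide) (by decide))
    apply iso_of_hom h hc E1_nc ![w 0, p1, p2, w 1, q1, q2, w 2, r2, r1, w 3]
    apply E1_hom
    simp only [List.forall_mem_cons, List.not_mem_nil, false_imp_iff, forall_const, and_true]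
    exact ⟨h1, h2, h3, k1, k2, k3, l3.symm, l2.symm, l1.symm, m1.symm, m2.symm, m3.symm⟩
  · right
    obtain ⟨p1, p2, h1, h2, h3⟩ := Cr.path2_of_rank (get 0 1 2 (by decide) (by decide))
    obtain ⟨a, a1, a2⟩ := Cr.path_of_rank (get 0 2 0 (by decide) (by decide))
    obtain ⟨b, b1, b2⟩ := Cr.path_of_rank (get 0 3 0 (by decide) (by decide))
    obtain ⟨c, c1, c2⟩ := Cr.path_of_rank (get 1 2 0 (by decide) (by decide))
    obtain ⟨d, d1, d2⟩ := Cr.path_of_rank (get 1 3 0 (by decide) (by decide))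
    have m3 := Cr.adj_of_rank (get 2 3 1 (by decide) (by decide))
    apply iso_of_hom h hc E2_nc ![w 2, w 3, b, w 0, a, d, w 1, c, p1, p2]
    apply E2_hom
    simp only [List.forall_mem_cons, List.not_mem_nil, false_imp_iff, forall_const, and_true]
    exact ⟨m3, b2.symm, b1.symm, a1, a2, d2.symm, d1.symm, c1, c2, h1, h2, h3⟩

/-! ## Part 5: the search runs -/

set_option maxRecDepth 100000
set_option maxHeartbeats 0

def pl_10_3 : List Nat := [0, 0, 0, 0, 1, 0, 0, 1, 0]

theorem run_10_3 : ∀ k, k < 1 → runS 10 3 1 pl_10_3 [] 1 k = true := by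
  intro k hk
  interval_cases k; decide +kernel

def pl_10_4 : List Nat := [0, 0, 0, 0, 6, 0, 6, 6, 0, 2, 0, 4]

theorem run_10_4 : ∀ k, k < 1 → runS 10 4 3 pl_10_4 [141976870852339152092993259831296, 81367322902204815222265742360576] 1 k = true := by
  intro k hk
  interval_cases k; decide +kernel

def pl_14_3 : List Nat := [0, 0, 0, 0, 0, 0, 0, 0, 0]

theorem run_14_3 : ∀ k, k < 1 → runS 14 3 0 pl_14_3 [] 1 k = true := by
  intro k hk
  interval_cases k; decide +kernel

def pl_14_4 : List Nat := [0, 0, 0, 0, 3, 0, 0, 3, 0, 0, 2, 0]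

theorem run_14_4 : ∀ k, k < 1 → runS 14 4 2 pl_14_4 [] 1 k = true := by
  intro k hk
  interval_cases k; decide +kernel

def pl_14_5 : List Nat := [0, 0, 0, 459264, 1629695, 0, 570926, 336414, 1198528, 248626, 1807334, 263168, 1575325, 2092569, 32]

theorem run_14_5 : ∀ k, k < 1 → runS 14 5 21 pl_14_5 [] 1 k = true := by
  intro k hk
  interval_cases k; decide +kernel

def pl_14_6 : List Nat := [0, 0, 0, 220203689864670697031756, 82027765038986596644787, 0, 38592087645874372982569, 29093004841227107976278, 233803343913539748759680, 244438543448688024736735, 20956294073624600313856, 38003805881026354359328, 226964199886384983097827, 151374125438755648807747, 68179310249072304063488, 75557575499800860215316, 73196680487779649516004, 226673591243720114766336]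

theorem run_14_6 : ∀ k, k < 1 → runS 14 6 78 pl_14_6 [] 1 k = true := by
  intro k hk
  interval_cases k; decide +kernel

def pl_18_3 : List Nat := [0, 0, 0, 0, 0, 0, 0, 0, 0]

theorem run_18_3 : ∀ k, k < 1 → runS 18 3 0 pl_18_3 [] 1 k = true := by
  intro k hk
  interval_cases k; decide +kernel

def pl_18_4 : List Nat := [0, 0, 0, 0, 1, 0, 1, 1, 0, 1, 0, 0]

theorem run_18_4 : ∀ k, k < 1 → runS 18 4 1 pl_18_4 [] 1 k = true := by
  intro k hk
  interval_cases k; decide +kernel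

def pl_18_5 : List Nat := [0, 0, 0, 0, 65535, 0, 63812, 14415, 1712, 26048, 41909, 6144, 4368, 49448, 0]

theorem run_18_5 : ∀ k, k < 1 → runS 18 5 16 pl_18_5 [] 1 k = true := by
  intro k hk
  interval_cases k; decide +kernel

def pl_18_6 : List Nat := [0, 0, 0, 875652873226729377416320065025511696367616, 4699533426405926407967609503136578680127487, 0, 1502700072852653008963129943084102001604051, 3711092391844807958913579770339586822108991, 12957320212442162626617499407494967986176, 1581859257779946929158268598501998489297936, 200369377694328439049764059699847264000847, 827907416745647155974828859821977732972704, 1813680800710128289202010522178703142823778, 2514697723198792876160199747546731139442311, 87112384595554452498529983950581579956240, 2254032537771590996954137514370603372692576, 2613371070823360782728014471719852472074336, 2787611759657306622421506396407830333886728]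

theorem run_18_6 : ∀ k, k < 1 → runS 18 6 142 pl_18_6 [] 1 k = true := by
  intro k hk
  interval_cases k; decide +kernel

def pl_18_7 : List Nat := [0, 0, 0, 558653946091629720984654356274812043885328112305510749827221725010565998240571046640793827752386824778279997449564759138892724561664107408814843477111990833897788079606787143431563570086546524883216, 39354259402541618764853469822547541526191562139066384137556306985695089732527382383208884513665927766672088922019197002450007349350544089948333924633719289236378759841109836119099981171778947626735, 0, 338511362252151245530230002735892617482009512332197991693327650764434179459319526619277862325212506573709926813269558608071616159595384416082977369866669697573315113918220848694858168877383542134072, 368290435559229665786427150070334048124670310604289945583523789728393255067954529286193898816156640728819380006276312878356599267644101684081122116432176478654907919183486149889385223495862869154109, 154213950666158633429492467681579651052156241029741975838975889420444513535723778028026736644231147418201443776049084247344389205125328436020546535901754161868316176967649901231297501123381215756864, 513938965268657700606360093046106928394413680751370181043659021772310929499732459651063430293250297175538200675633920667936099215312775372278537640394415389608764106672232423559171548315641990211843, 48978864701609534386144158222040422642605452996724937433197654449387728293962090664357739612198905561678778826489982464026638079101992580875592743382367865452171583716687762469216310948898586126839, 7009049419490505879717263102032362220594111463172764025410197074749976669338653135296668947852368084860000966334177654011862330492681610440747042802817852409807792752493543893733857828053037614592,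 327076249059689998252944495451953728372503953274471696841731661573747751917884608646858593438143931585845478303735462064482169505818340496996512674687653788914922022525024807967984134655994901495808, 539647774187598865442801119982884492079292855770665073225142056516846166786102740992353678042503534959781524193003627325338467397057320585366167226154326988357756344719463857258036085602890039176984, 4616037523287212685139730585345454389362144671300399695478830756753112261274863002534364914864537640662200959414067088689650683740098711748262933900179111274120323568818410641178416744138539008, 37886578071900292474857471188614709593783829461213980524288976842028969650725789165180292235906718137490105993646868468731386500206144229826644877018868156970783453077601717503811966899548514395759, 547564127441716422411636228424323880087156662721316208358871276376780402474335508077576862773003148662432457158903171424672586729607416137486871421343947640767039858673261024516104900745030518112, 242365899201207538197640623376937049223789012606757580350072716036943447783302227537154997930463257951528575151130975317617939737854929918171512250045996868509237291265161796210302255511552164630656, 280325476427925922208043923133982620925323896656324317482399536302999229353393895401620657241095552646825841923503384011277330785739526434195080686399625702428068437145121838477139335435183726797028, 298994983435252941458493855624605625916896564395073062397197521096588457777243216540694507320569262485683122198105873655105206998091128358206098659310613788618041317314572643584138298557753028784260, 2990041083164881858493110384306141025665554255110692019344212292150242937182322049275715505741976905936210009457614410451802362914843211163822612156911546755730262531420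48133940208578131704619780121]

theorem run_18_7 : ∀ k, k < 11 → runS 18 7 657 pl_18_7 [] 11 k = true := by
  intro k hk
  interval_cases k <;> decide +kernel

def pl_18_8 : List Nat := [0, 0, 0, 21816989476926775527064973211942951469370292995601505279774169874619907029264270977452037404018537481767828159726026508279560162397018197200664731476316521525725072742232541744343654138474121660712161781517454667052264553499776840009656121058165030510932295928034997765933418533633805353605482202088323559664563752679502132689061765151375474172447358302073691441901126130467151281522999364, 319230132677836253589461301835123403459974620322833877780922503623405521870112399267813024622666261407148643286327853555028496536428045100909263728178517925233772803021433430545952017863236648121185772510989245066732513859271091715502971124307107882728553312345841120263613416124572074300097373089313303739260167752473006460313792568943426094517828612597441680920718842113022130151391756219, 0, 232777228383037192395816619511933857154713409633780865183994061158734989811984673471736085799485683066630217524952635635021685215885507216329276754718040487178092817170440034391874672764903494255984079832531416113522487968450997416222002023367149188624662528807867437178714849709782096036557367702480648720140976992897590008787342515735703126261126648606196592141051742038892858066519883506, 170535921887870235637946151474053390400575268410602931043998868079389941910396410734694991155302543585439539109226419734699355024908207985837022044237358085091981043123161049367233934772331823176596737550081011815195232435579890316294413953187948236161194148571452681597614163544436136018633399982488038069239255750510821476267260551954814066360553448164035075497519008895523184999953367819,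 108268550711033774117642809619627028632737293051624022118446590198807034297349901534490519993336363950528485345959112745775046320554566114320380994416691293200529886427467346532416860091346548189414717993912819949610397844199066713441894331393771094960226362998346042227657270537517420884486953495765571019867053102322574292809171776475546922615752151234635777934256546539017495415082778628, 198874962890145145607305965131319645190126472985304546000987574834823282191722288895621170426894634341978712663567070695525075665236492523085808078876774553398403744759489913999555340040789832346681932821608155973395019827535532851580483138566587661262193853638735100282955074798189835931495483585014217154317261544033037529547269581315771847034621267581228564182498608273475927335439297823, 85324878789263956135365587344831600410524630031706311245909793215159163087053981216020421818037098479720121087628839315631393700755380483964335646637505891186575217664865497040334783252494120150870536021499360468399477884768522933419292503823235586295102065402468550458859365388421008097617513766962420839786505813413821955605600550795594033704091917332840076732228414380763093985178681344, 264182919587283869471886919943870169265472430297595699236848051275942174232011483483179340066816873240819475587597852165127990881339886313193371277584436722735834604747402611473672723393058476332339306321160115507687575240055841833419033589806454955036880239819342801252856707136718181504411238023602585279331025928806600445520599966459496229148037955598612940496120558325713589784679136, 257120606136562752274300526419465676687716233564403185150488143959720500922320541254388429855336729361084631660866784360260740554873115077377256944234966011358474953822633603728603614970166455980186565464826382631655468460099157892522782621083235651373559960906439926772893232786489452191537628329787988192966340765965414175544538698205989746075849847634241147946793548160980083930268041019,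 172275183541633984825448286397784177873679016490568588658079912940756130381060753573991682529740482963819862038490375937447288814923461220562747192176951980477556576922774041200784544851045379665011765241240105067551907457360402382608581763765174134941807647349834988449833214659236030155559127200983430621859793088558506973497527725658609442301836718716053771006600329290238864175341583706, 61948663061094923059025650293021663194314667620543137581716149183167526650788463575604138480145246208790283954939422391381219560918071713346824022054016892721569592715794547438444741608522780711970447479803156160481424810174823716819342171261217424707003639408402172648359523952436759443132829465322714356949253370305758130006247865484826680102062347272611694162876535673159785305216123008, 94600299759960113088970270262799187669486226396714941262030028733169989790600697645291614001645728074441052883584863120471765499030030226777400482885912185448090113069829692395552683256796022504246524917331913112498384240257183123458894845610432583455360699879074376490791203865370094251080388025305579746538089898499006609099435274004031315470058855976142762338995699791875418313375908613, 201336246721881185498792857909901751658677806415753497902111880219775519869521999929958656617863880633551998165288677073364692150427293983916261425108581199742711422285957479103794071189711859468559917938065455333893223991626551677959138973211080553031462311024219495293719397166091199224232877733287824467415317244386480996143164515729233435702159299681818298172863565197813383944130971940, 11658182508617241055842432977136944815250842045233588102900800764196941785408316664553523537683685110279737257300381037659128123198540051419523239782092959354519715635571244943666565292575993610848681632842622381336478919352142134683552024412128318995725236253684418860136204068154928575590474660490001987448200982626605627391176243796334029494024655476733112094089734946613432324860215298,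 59940582500519063405962911932779619642214105722176727174840880004808653916158986018501981556483966078791061818884823783350104067860106417509871464825306734531571114412574857685176564626071632562854120471993472603131787776983526342358132524814565207323442137175580108634276712354238673779897257087098156080594410546456310334284507343479573036647798440252392737953359185904066568149006680108, 65259035852070114110311603483149961368239562113843754196521167495647401601502947636182079850062360941097101278999681023106661011877690491285748974494175687500718163325916459251526131586283843914504161000453376271221246785478272162792512648981696239071064859109525828842856134921595231035949512059413193524057642866846372271461787910197569733512883250799401710089416521687978867640783778468, 89267533442112217875787611751721953675293150765781508056027173625437544665662056402235236342305623621420298872208158557342056537209559499549880059537739515235182823270360270687371878605710149439093382402375353444109635320475454931542625185036288633164522906473098283329919925439559081737941508017997292939020293862557465525435166777613959204372432768375113341901010663363584260464516811778, 165205107725908006627399269189358276398405526046914517339462633485300527971252743458645597116493213959663579988711224082076666998833096677134304266327701360344539644755092801476622225474669329449308351279088823933842302747014626130541722619652896601557525058709628657571724819715435664436802021163244055833997176096403817436542024323959720821936474150616124071175454066271425741400017340560, 170513153145186850159181212283205813379133841396999594064128049962972066153835800975172787917785764946224942755176650808964846372134933914883549561536335417328008970835631427644301212114848625431506879422270819119049843506412698225041469393633593644479068295685828818586017435485854148629725895951559389881676560284434539783579017547881738161675114846079843211871684705697415464646247782865,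 170523561077381514558263137523533177464672456689057822825162709798695874647303477309882679219822209340807450462747867444860676900048225630906746033605557004567898445899745362092527672696574364041875733190286475063465791766681298987942947872250338723526663678045807592082330545765718280388788736926355740653230087133065441878538836832598694035897105348380718781378598631168842097317770437636]

theorem run_18_8 : ∀ k, k < 11 → runS 18 8 1294 pl_18_8 [] 11 k = true := by
  intro k hk
  interval_cases k <;> decide +kernel


/-! ## Part 6: conclusion -/

theorem no_small {V : Type} [Fintype V] {G : SimpleGraph V} (h : Critical52 G) {n : ℕ}
    (hV : Fintype.card V = n) (he : 4 * G.edgeSet.ncard + 2 = 5 * n) (n6 : 6 ≤ n) (hn : n ≤ 18)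
    (hi1 : IsEmpty (G ≃g E1)) (hi2 : IsEmpty (G ≃g E2)) : False := by
  classical
  have hC := h.cr
  have hR := hC.rsys (by omega)
  obtain ⟨s1, s2⟩ := hC.rsum (by omega) hV he
  obtain ⟨N, hN⟩ : ∃ N, Fintype.card {v // Cr.Br G v} = N := ⟨_, rfl⟩
  rw [hN] at s1 s2
  obtain ⟨b1, b2⟩ := hR.bounds hN n6 hn s1
  obtain ⟨e, hG⟩ := hR.good hN b1 (by omega) hn s1 s2
  have fin1 : (∃ g : ℕ → Fin 5, ∀ i j, i < j → j < N → okd (RSys.mx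
      (fun u v : {v // Cr.Br G v} => Cr.rank G u.1 v.1) e i j) (g j - g i).val = true) → False := by
    rintro ⟨g, hg⟩
    apply hR.nc (fun w => g (e.symm w).val)
    intro u v
    have key : ∀ u v, (e.symm u).val < (e.symm v).val →
        okp (Cr.rank G u.1 v.1) (g (e.symm u).val) (g (e.symm v).val) := by
      intro u v huv
      have := hg _ _ huv (e.symm v).2
      rw [RSys.mx_of e (e.symm u).2 (e.symm v).2] at this
      simpa [okp] using this
    rcases lt_trichotomy (e.symm u).val (e.symm v).val with h1 | h1 | h1
    · exact key u v h1
    · have : u = v := e.symm.injective (Fin.ext h1)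
      rw [this, hC.rank_self (by omega)]
      exact okp_zero _ _
    · rw [Cr.rank_symm]
      exact okp_symm (Cr.rank_le _ _) (key v u h1)
  have fin2 : ∀ {L : ℕ} {pl : List ℕ} {m : ℕ}, 0 < m →
      (∀ k, k < m → runS n N L pl [] m k = true) → False := by
    intro L pl m hm hrun
    rcases runS_sound hm hG hrun with h1 | ⟨P, hP, _⟩
    · exact fin1 h1
    · simp at hP
  have hcase : n = 6 ∨ n = 10 ∨ n = 14 ∨ n = 18 := by omega
  rcases hcase with rfl | rfl | rfl | rfl
  · omega
  · have : N = 3 ∨ N = 4 := by omega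
    rcases this with rfl | rfl
    · exact fin2 (by omega) run_10_3
    · rcases runS_sound (by omega) hG run_10_4 with h1 | ⟨P, hP, hb⟩
      · exact fin1 h1
      · rcases exc_iso h hV (fun i => (e i).1) _ hG.le4 (fun i j => RSys.mx_of e i.2 j.2) hP hb with
          ⟨⟨f⟩⟩ | ⟨⟨f⟩⟩
        · exact hi1.elim f
        · exact hi2.elim f
  · have : N = 3 ∨ N = 4 ∨ N = 5 ∨ N = 6 := by omega
    rcases this with rfl | rfl | rfl | rfl
    · exact fin2 (by omega) run_14_3
    · exact fin2 (by omega) run_14_4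
    · exact fin2 (by omega) run_14_5
    · exact fin2 (by omega) run_14_6
  · have : N = 3 ∨ N = 4 ∨ N = 5 ∨ N = 6 ∨ N = 7 ∨ N = 8 := by omega
    rcases this with rfl | rfl | rfl | rfl | rfl | rfl
    · exact fin2 (by omega) run_18_3
    · exact fin2 (by omega) run_18_4
    · exact fin2 (by omega) run_18_5
    · exact fin2 (by omega) run_18_6
    · exact fin2 (by omega) run_18_7
    · exact fin2 (by omega) run_18_8


/-- If `G` is a smallest counterexample with `p(G) = 2`,
then `G` has at least 22 vertices. -/
theorem smallestCex_pot_two_at_least_22 {V : Type} [Fintype V] (G : SimpleGraph V)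
    (h : SmallestCex G) (hpot : pot G = 2) :
    22 ≤ Fintype.card V := by
  obtain ⟨hc, _, hi1, hi2, _, _⟩ := h
  unfold pot at hpot
  by_contra hlt
  have he : 4 * G.edgeSet.ncard + 2 = 5 * Fintype.card V := by omega
  by_cases h6 : 6 ≤ Fintype.card V
  · exact no_small hc rfl he h6 (by omega) hi1 hi2
  · have h2 : Fintype.card V = 2 := by omega
    have hC := hc.cr
    have hne : Nonempty V := Fintype.card_pos_iff.1 (by omega)
    obtain ⟨v⟩ := hne
    obtain ⟨w, hw⟩ := hC.noiso v
    obtain ⟨y, hy, hyw⟩ := hC.two_nb v w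
    have : ({v, w, y} : Set V).ncard = 3 := by
      rw [Set.ncard_eq_three]
      exact ⟨v, w, y, hw.ne, hy.ne, hyw.symm, rfl⟩
    have h3 := Set.ncard_le_ncard (Set.subset_univ ({v, w, y} : Set V))
    rw [Set.ncard_univ, Nat.card_eq_fintype_card] at h3
    omega
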